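/- arXiv:2302.06636 — 4 statements merged into one kernel-verified Lean document; each statement's English description precedes it below -/
import Mathlib

section
/- In extremal Kerr normalized so that a=M=r₊=1 (so Δ=(r−1)² and ω₊=1/2), the exact identity (r²+cos²θ)·q(K) = (r−1)²·(−1 + sin²θ·(2+(r−1)+¼(r−1)²) − ¼sin⁴θ) holds for all r≥1 and θ∈[0,π]. Consequently q(K)=0 on the horizon r=1 and q(K) vanishes there to second order in r−1; moreover, for every δ>0, q(K) takes both strictly negative values (e.g. for θ near 0) and strictly positive values (e.g. for θ=π/2) at points with 1<r<1+δ. In particular, in extremal Kerr the horizon generator K is neither uniformly timelike nor uniformly spacelike on any one-sided neighbourhood {r₊<r<r₊+δ} of the horizon. -/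
noncomputable section

/-- `ρ²(r,θ) = r² + a² cos²θ`. -/
def rhoSq (a r θ : ℝ) : ℝ := r ^ 2 + a ^ 2 * Real.cos θ ^ 2

/-- `Δ(r) = r² − 2Mr + a²`. -/
def kDelta (M a r : ℝ) : ℝ := r ^ 2 - 2 * M * r + a ^ 2

/-- The Kerr metric `g_{M,a}` in ingoing Eddington–Finkelstein coordinates `(v, r, θ, φ*)`. -/
def kerrMetric (M a r θ : ℝ) : Matrix (Fin 4) (Fin 4) ℝ :=
  !![-(rhoSq a r θ)⁻¹ * (kDelta M a r - a ^ 2 * Real.sin θ ^ 2), 1, 0,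
      -(2 * M * a * r) * (rhoSq a r θ)⁻¹ * Real.sin θ ^ 2;
    1, 0, 0, -(a * Real.sin θ ^ 2);
    0, 0, rhoSq a r θ, 0;
    -(2 * M * a * r) * (rhoSq a r θ)⁻¹ * Real.sin θ ^ 2, -(a * Real.sin θ ^ 2), 0,
      (rhoSq a r θ)⁻¹ * ((r ^ 2 + a ^ 2) ^ 2 - a ^ 2 * kDelta M a r * Real.sin θ ^ 2) *
        Real.sin θ ^ 2]

/-- The quadratic form `q(X) = Σ_{α,β} g_{αβ} X^α X^β`. -/
def qform (M a r θ : ℝ) (X : Fin 4 → ℝ) : ℝ :=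
  ∑ α : Fin 4, ∑ β : Fin 4, kerrMetric M a r θ α β * X α * X β

/-- In extremal Kerr normalized so that `a = M = r₊ = 1`, the horizon generator is
`K = ∂_v + (1/2)∂_{φ*}` (since `ω₊ = 1/2`). -/
def Kext : Fin 4 → ℝ := ![1, 0, 0, 1 / 2]

/-- `q(K)` in normalized extremal Kerr, as a function of `(r, θ)`. -/
def qK (r θ : ℝ) : ℝ := qform 1 1 r θ Kext

/-- The identity `ρ² q(K) = (r-1)² (…)` for the horizon generator of extremal Kerr. -/
theorem rhoSq_mul_qK {r : ℝ} (hr : r ≠ 0) (θ : ℝ) :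
    (r ^ 2 + Real.cos θ ^ 2) * qK r θ =
      (r - 1) ^ 2 *
        (-1 + Real.sin θ ^ 2 * (2 + (r - 1) + 1 / 4 * (r - 1) ^ 2)
          - 1 / 4 * Real.sin θ ^ 4) := by
  have hρ : r ^ 2 + Real.cos θ ^ 2 ≠ 0 := by positivity
  simp [qK, qform, Kext, kerrMetric, Fin.sum_univ_four, rhoSq, kDelta]
  field_simp
  ring

theorem abs_qK_le {r : ℝ} (h1 : 1 ≤ r) (h2 : r ≤ 2) (θ : ℝ) :
    |qK r θ| ≤ 4 * (r - 1) ^ 2 := by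
  have hid := rhoSq_mul_qK (by linarith : r ≠ 0) θ
  have hρ : 1 ≤ r ^ 2 + Real.cos θ ^ 2 := by nlinarith [sq_nonneg (Real.cos θ)]
  have hs0 : 0 ≤ Real.sin θ ^ 2 := sq_nonneg _
  have hs1 : Real.sin θ ^ 2 ≤ 1 := Real.sin_sq_le_one θ
  have hs4 : Real.sin θ ^ 4 = (Real.sin θ ^ 2) ^ 2 := by ring
  have hp0 : 0 ≤ 2 + (r - 1) + 1 / 4 * (r - 1) ^ 2 := by nlinarith
  have hp1 : 2 + (r - 1) + 1 / 4 * (r - 1) ^ 2 ≤ 4 := by nlinarith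
  have hbracket : |-1 + Real.sin θ ^ 2 * (2 + (r - 1) + 1 / 4 * (r - 1) ^ 2)
      - 1 / 4 * Real.sin θ ^ 4| ≤ 4 := by
    rw [hs4, abs_le]
    constructor <;> nlinarith [mul_nonneg hs0 hp0, mul_le_mul hs1 hp1 hp0 zero_le_one]
  calc |qK r θ| ≤ (r ^ 2 + Real.cos θ ^ 2) * |qK r θ| :=
        le_mul_of_one_le_left (abs_nonneg _) hρ
    _ = |(r ^ 2 + Real.cos θ ^ 2) * qK r θ| := by
        rw [abs_mul, abs_of_nonneg (zero_le_one.trans hρ)]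
    _ ≤ (r - 1) ^ 2 * 4 := by
        rw [hid, abs_mul, abs_of_nonneg (sq_nonneg (r - 1))]
        exact mul_le_mul_of_nonneg_left hbracket (sq_nonneg _)
    _ = 4 * (r - 1) ^ 2 := mul_comm _ _

theorem qK_axis_neg {r : ℝ} (hr : 1 < r) : qK r 0 < 0 := by
  have hid := rhoSq_mul_qK (by linarith : r ≠ 0) 0
  have hx : 0 < (r - 1) ^ 2 := pow_pos (sub_pos.2 hr) 2
  simp only [Real.sin_zero, Real.cos_zero] at hid
  refine neg_of_mul_neg_right (a := r ^ 2 + 1 ^ 2) ?_ (by positivity)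
  rw [hid]
  linarith

theorem qK_equator_pos {r : ℝ} (hr : 1 < r) : 0 < qK r (Real.pi / 2) := by
  have hid := rhoSq_mul_qK (by linarith : r ≠ 0) (Real.pi / 2)
  have hx : 0 < (r - 1) ^ 2 := pow_pos (sub_pos.2 hr) 2
  simp only [Real.sin_pi_div_two, Real.cos_pi_div_two] at hid
  refine pos_of_mul_pos_right (a := r ^ 2 + 0 ^ 2) ?_ (by positivity)
  rw [hid]
  exact mul_pos hx (by linarith)

/-- in extremal Kerr (normalized `a = M = r₊ = 1`) one has the exact identity
`(r²+cos²θ)·q(K) = (r−1)²·(−1 + sin²θ·(2+(r−1)+¼(r−1)²) − ¼sin⁴θ)`; hence `q(K)` vanishes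
on the horizon `r = 1` to second order in `r−1`, and for every `δ > 0`, `q(K)` takes both
strictly negative and strictly positive values on `{1 < r < 1+δ}`: the horizon generator is
neither uniformly timelike nor uniformly spacelike on any one-sided neighbourhood of the
horizon. -/
theorem extremal_horizon_generator_causal_character :
    (∀ r θ : ℝ, 1 ≤ r → θ ∈ Set.Icc (0 : ℝ) Real.pi →
      (r ^ 2 + Real.cos θ ^ 2) * qK r θ =
        (r - 1) ^ 2 *
          (-1 + Real.sin θ ^ 2 * (2 + (r - 1) + 1 / 4 * (r - 1) ^ 2)
            - 1 / 4 * Real.sin θ ^ 4)) ∧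
    (∀ θ : ℝ, qK 1 θ = 0) ∧
    (∃ C > 0, ∀ r θ : ℝ, 1 ≤ r → r ≤ 2 → θ ∈ Set.Icc (0 : ℝ) Real.pi →
      |qK r θ| ≤ C * (r - 1) ^ 2) ∧
    (∀ δ : ℝ, 0 < δ →
      (∃ r θ : ℝ, 1 < r ∧ r < 1 + δ ∧ qK r θ < 0) ∧
      (∃ r θ : ℝ, 1 < r ∧ r < 1 + δ ∧ 0 < qK r θ)) := by
  refine ⟨fun r θ hr _ => rhoSq_mul_qK (by linarith) θ, fun θ => ?_,
    ⟨4, by norm_num, fun r θ h1 h2 _ => abs_qK_le h1 h2 θ⟩, fun δ hδ =>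
    ⟨⟨1 + δ / 2, 0, by linarith, by linarith, qK_axis_neg (by linarith)⟩,
      ⟨1 + δ / 2, Real.pi / 2, by linarith, by linarith, qK_equator_pos (by linarith)⟩⟩⟩
  simpa using abs_qK_le le_rfl one_le_two θ
end
end

section
/- Let M>0 and a=M (extremal Kerr, r₊=M, Δ=(r−M)²). For p∈ℝ define on {r>M} the vector field V_p := L + (r−M)^{−p} L̄. Then for all r>M and all θ: q(V_p) = −ρ⁻²(r−M)^{2−p}(r²+M²)⁻¹·(r²+M²cos 2θ+M⁴(r²+M²)⁻¹sin⁴θ), and the factor r²+M²cos 2θ+M⁴(r²+M²)⁻¹sin⁴θ is strictly positive for every r≥M and every θ. Consequently V_p is timelike on {r>M} for every p∈ℝ; if p<2 then q(V_p)→0 as r→M⁺, while for p=2 the limit of q(V_p) as r→M⁺ is strictly negative for every θ (V₂ is timelike up to and including the horizon). -/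
noncomputable section

/-- In extremal Kerr (`a = M`, `Δ = (r−M)²`):
`V_p = L + (r−M)^{−p} L̄ = T + M(r²+M²)⁻¹Φ + ((r−M)^{−p} − 1)·L̄`, where
`L̄ = −Δ(2(r²+M²))⁻¹ Y`, `L = T + M(r²+M²)⁻¹Φ − L̄`. -/
def Vp (M p r : ℝ) : Fin 4 → ℝ :=
  ![1, -(kDelta M M r) / (2 * (r ^ 2 + M ^ 2)) * ((r - M) ^ (-p) - 1), 0,
    M / (r ^ 2 + M ^ 2)]

lemma rhoSq_pos {a r : ℝ} (hr : r ≠ 0) (θ : ℝ) : 0 < rhoSq a r θ := by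
  unfold rhoSq
  positivity

lemma angular_factor_eq {M r : ℝ} (hr : r ≠ 0) (θ : ℝ) :
    r ^ 2 + M ^ 2 * Real.cos (2 * θ) + M ^ 4 * (r ^ 2 + M ^ 2)⁻¹ * Real.sin θ ^ 4 =
      rhoSq M r θ ^ 2 / (r ^ 2 + M ^ 2) := by
  have hR : r ^ 2 + M ^ 2 ≠ 0 := by positivity
  rw [Real.cos_two_mul, show Real.sin θ ^ 4 = (Real.sin θ ^ 2) ^ 2 by ring, Real.sin_sq]
  unfold rhoSq
  field_simp
  ring

lemma kDelta_extremal (M r : ℝ) : kDelta M M r = (r - M) ^ 2 := by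
  unfold kDelta
  ring

lemma qform_Vp {M r : ℝ} (hr : r ≠ 0) (p θ : ℝ) :
    qform M M r θ (Vp M p r) =
      -((r - M) ^ 2 * (r - M) ^ (-p) * rhoSq M r θ / (r ^ 2 + M ^ 2) ^ 2) := by
  have hR : r ^ 2 + M ^ 2 ≠ 0 := by positivity
  have hρ : rhoSq M r θ ≠ 0 := (rhoSq_pos hr θ).ne'
  simp only [qform, Vp, kerrMetric, Fin.sum_univ_four, Matrix.of_apply, Matrix.cons_val,
    kDelta_extremal, Real.sin_sq]
  generalize (r - M) ^ (-p) = s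
  field_simp
  unfold rhoSq
  ring

lemma qform_Vp_of_lt {M r : ℝ} (hM : 0 < M) (hr : M < r) (p θ : ℝ) :
    qform M M r θ (Vp M p r) =
      -((r - M) ^ (2 - p) * rhoSq M r θ / (r ^ 2 + M ^ 2) ^ 2) := by
  rw [qform_Vp (hM.trans hr).ne', sub_eq_add_neg 2 p, Real.rpow_add (sub_pos.2 hr), Real.rpow_two]

lemma tendsto_qform_Vp {M p : ℝ} (hM : 0 < M) (hp : p ≤ 2) (θ : ℝ) :
    Filter.Tendsto (fun r => qform M M r θ (Vp M p r)) (nhdsWithin M (Set.Ioi M))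
      (nhds (-((M - M) ^ (2 - p) * rhoSq M M θ / (M ^ 2 + M ^ 2) ^ 2))) := by
  have hcont : ContinuousAt
      (fun r : ℝ => -((r - M) ^ (2 - p) * rhoSq M r θ / (r ^ 2 + M ^ 2) ^ 2)) M := by
    have hpow : ContinuousAt (fun r : ℝ => (r - M) ^ (2 - p)) M :=
      (continuousAt_id.sub continuousAt_const).rpow_const (Or.inr (sub_nonneg.2 hp))
    have hρ : ContinuousAt (fun r : ℝ => rhoSq M r θ) M := by
      unfold rhoSq
      fun_prop
    exact ((hpow.mul hρ).div (by fun_prop) (by positivity)).neg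
  refine (hcont.tendsto.mono_left nhdsWithin_le_nhds).congr' ?_
  filter_upwards [self_mem_nhdsWithin] with r hr
  exact (qform_Vp_of_lt hM hr p θ).symm


/-- in extremal Kerr (`a = M`, `M > 0`), for every `p ∈ ℝ`,
`q(V_p) = −ρ⁻²(r−M)^{2−p}(r²+M²)⁻¹·(r²+M²cos 2θ+M⁴(r²+M²)⁻¹sin⁴θ)` on `{r > M}`,
the last factor is strictly positive for all `r ≥ M` and all `θ`; consequently `V_p` is
timelike on `{r > M}`; if `p < 2` then `q(V_p) → 0` as `r → M⁺`, and for `p = 2` the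
limit of `q(V_p)` as `r → M⁺` is strictly negative for every `θ`. -/
theorem Vp_timelike (M p : ℝ) (hM : 0 < M) :
    (∀ r θ : ℝ, M < r →
      qform M M r θ (Vp M p r) =
        -(rhoSq M r θ)⁻¹ * (r - M) ^ (2 - p) * (r ^ 2 + M ^ 2)⁻¹ *
          (r ^ 2 + M ^ 2 * Real.cos (2 * θ) + M ^ 4 * (r ^ 2 + M ^ 2)⁻¹ * Real.sin θ ^ 4)) ∧
    (∀ r θ : ℝ, M ≤ r →
      0 < r ^ 2 + M ^ 2 * Real.cos (2 * θ) + M ^ 4 * (r ^ 2 + M ^ 2)⁻¹ * Real.sin θ ^ 4) ∧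
    (∀ r θ : ℝ, M < r → qform M M r θ (Vp M p r) < 0) ∧
    (p < 2 → ∀ θ : ℝ,
      Filter.Tendsto (fun r => qform M M r θ (Vp M p r)) (nhdsWithin M (Set.Ioi M))
        (nhds 0)) ∧
    (p = 2 → ∀ θ : ℝ, ∃ L : ℝ, L < 0 ∧
      Filter.Tendsto (fun r => qform M M r θ (Vp M p r)) (nhdsWithin M (Set.Ioi M))
        (nhds L)) := by
  refine ⟨fun r θ hr => ?_, fun r θ hr => ?_, fun r θ hr => ?_, fun hp θ => ?_, fun hp θ => ?_⟩
  · have hr0 : r ≠ 0 := (hM.trans hr).ne'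
    have hρ : rhoSq M r θ ≠ 0 := (rhoSq_pos hr0 θ).ne'
    have hR : r ^ 2 + M ^ 2 ≠ 0 := by positivity
    rw [qform_Vp_of_lt hM hr, angular_factor_eq hr0]
    field_simp
  · have hr0 : r ≠ 0 := (hM.trans_le hr).ne'
    have hρ := rhoSq_pos (a := M) hr0 θ
    rw [angular_factor_eq hr0]
    positivity
  · have hρ := rhoSq_pos (a := M) (hM.trans hr).ne' θ
    have hpow := Real.rpow_pos_of_pos (sub_pos.2 hr) (2 - p)
    rw [qform_Vp_of_lt hM hr, neg_lt_zero]
    positivity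
  · simpa [Real.zero_rpow (sub_pos.2 hp).ne'] using tendsto_qform_Vp hM hp.le θ
  · refine ⟨_, ?_, tendsto_qform_Vp hM hp.le θ⟩
    have hρ := rhoSq_pos (a := M) hM.ne' θ
    rw [hp, sub_self, sub_self, Real.rpow_zero, one_mul, neg_lt_zero]
    positivity
end
end

section
/- For m∈ℤ with m≠0 let Λ_m be the infimum, over all f∈C¹((0,π);ℝ) that are not almost everywhere zero and for which ∫₀^π f(θ)² sinθ dθ, ∫₀^π f′(θ)² sinθ dθ and ∫₀^π f(θ)² (sinθ)⁻¹ dθ are all finite, of the Rayleigh quotient R_m(f) = [∫₀^π ( f′(θ)² + m²((sinθ)⁻² + ¼ sin²θ) f(θ)² ) sinθ dθ] / [∫₀^π f(θ)² sinθ dθ], and set α_m := Λ_m − 2m² + ¼. Then: (a) if |m|=1, α_m ≥ ¼ (equivalently Λ_m ≥ 2); (b) if |m|≥2, then Λ_m ≤ (17/10)m² + ½ and hence α_m ≤ −(9/80)m² < 0. -/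
noncomputable section

open MeasureTheory

/-- The set of Rayleigh quotient values `R_m(f)` over all admissible test functions `f`:
`f ∈ C¹((0,π);ℝ)`, not almost everywhere zero, with `∫ f² sinθ`, `∫ f′² sinθ` and
`∫ f² (sinθ)⁻¹` all finite, where
`R_m(f) = [∫₀^π (f′² + m²((sinθ)⁻² + ¼ sin²θ) f²) sinθ dθ] / [∫₀^π f² sinθ dθ]`. -/
def RayleighSet (m : ℤ) : Set ℝ :=
  {R | ∃ f : ℝ → ℝ,
    ContDiffOn ℝ 1 f (Set.Ioo 0 Real.pi) ∧
    IntegrableOn (fun θ => f θ ^ 2 * Real.sin θ) (Set.Ioo 0 Real.pi) ∧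
    IntegrableOn (fun θ => deriv f θ ^ 2 * Real.sin θ) (Set.Ioo 0 Real.pi) ∧
    IntegrableOn (fun θ => f θ ^ 2 * (Real.sin θ)⁻¹) (Set.Ioo 0 Real.pi) ∧
    ¬ (∀ᵐ θ ∂(volume.restrict (Set.Ioo 0 Real.pi)), f θ = 0) ∧
    R = (∫ θ in Set.Ioo 0 Real.pi,
          (deriv f θ ^ 2 +
            (m : ℝ) ^ 2 * ((Real.sin θ ^ 2)⁻¹ + 1 / 4 * Real.sin θ ^ 2) * f θ ^ 2)
            * Real.sin θ) /
        (∫ θ in Set.Ioo 0 Real.pi, f θ ^ 2 * Real.sin θ)}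

/-- `Λ_m`: the lowest spheroidal eigenvalue `Λ_{+,m|m|}` on extremal Kerr, via its
Rayleigh–Ritz variational characterization. -/
def LambdaM (m : ℤ) : ℝ := sInf (RayleighSet m)

/-- `α_m = Λ_m − 2m² + ¼`. -/
def alphaM (m : ℤ) : ℝ := LambdaM m - 2 * (m : ℝ) ^ 2 + 1 / 4

open Set in
/-- A continuous function whose quotient by `x` is integrable near `0` vanishes at `0`. -/
lemma eq_zero_of_integrableOn_mul_inv {h : ℝ → ℝ} {b : ℝ} (hb : 0 < b)
    (hc : ContinuousOn h (Icc 0 b)) (hi : IntegrableOn (fun x => h x * x⁻¹) (Ioo 0 b)) :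
    h 0 = 0 := by
  by_contra h0
  have hpos : 0 < |h 0| / 2 := by positivity
  have hev : ∀ᶠ x in nhdsWithin 0 (Icc 0 b), |h 0| / 2 < |h x| :=
    ((hc 0 ⟨le_rfl, hb.le⟩).abs).eventually (lt_mem_nhds (half_lt_self (abs_pos.mpr h0)))
  obtain ⟨δ, hδ, hball⟩ := Metric.mem_nhdsWithin_iff.mp hev
  set d := min δ b
  have hd : 0 < d := lt_min hδ hb
  have hi' : IntegrableOn (fun x => h x * x⁻¹) (Ioo 0 d) :=
    hi.mono_set (Ioo_subset_Ioo_right (min_le_right _ _))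
  have hinv : IntegrableOn (fun x : ℝ => x⁻¹) (Ioo 0 d) := by
    refine Integrable.mono' (hi'.norm.const_mul (|h 0| / 2)⁻¹)
      measurable_inv.aestronglyMeasurable ?_
    refine (ae_restrict_mem measurableSet_Ioo).mono fun x hx => ?_
    have hxδ : |h 0| / 2 < |h x| := by
      refine hball ⟨?_, hx.1.le, (hx.2.trans_le (min_le_right _ _)).le⟩
      rw [Metric.mem_ball, Real.dist_eq, sub_zero, abs_of_pos hx.1]
      exact hx.2.trans_le (min_le_left _ _)
    rw [norm_mul, Real.norm_eq_abs, Real.norm_eq_abs, ← mul_assoc]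
    refine le_mul_of_one_le_left (abs_nonneg _) ?_
    rw [inv_mul_eq_div, one_le_div hpos]
    exact hxδ.le
  have : IntervalIntegrable (fun x : ℝ => x⁻¹) volume 0 d := by
    rwa [intervalIntegrable_iff_integrableOn_Ioo_of_le hd.le]
  rw [intervalIntegrable_inv_iff] at this
  rcases this with h | h
  · exact hd.ne h
  · exact h left_mem_uIcc

open Set in
/-- A continuous function on `[0, π]` whose quotient by `sin` is integrable vanishes at `0`. -/
lemma eq_zero_of_integrableOn_mul_inv_sin {h : ℝ → ℝ} (hc : ContinuousOn h (Icc 0 Real.pi))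
    (hi : IntegrableOn (fun x => h x * (Real.sin x)⁻¹) (Ioo 0 Real.pi)) :
    h 0 = 0 := by
  refine eq_zero_of_integrableOn_mul_inv Real.pi_pos hc (Integrable.mono hi ?_ ?_)
  · refine ContinuousOn.aestronglyMeasurable ?_ measurableSet_Ioo
    exact (hc.mono Ioo_subset_Icc_self).mul (continuousOn_inv₀.mono fun x hx => hx.1.ne')
  · refine (ae_restrict_mem measurableSet_Ioo).mono fun x hx => ?_
    have hs := Real.sin_pos_of_mem_Ioo hx
    rw [norm_mul, norm_mul, norm_inv, norm_inv, Real.norm_of_nonneg hx.1.le,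
      Real.norm_of_nonneg hs.le]
    have := Real.sin_le hx.1.le
    gcongr

open Set in
lemma endpoints_eq_zero_of_integrableOn_mul_inv_sin {h : ℝ → ℝ}
    (hc : ContinuousOn h (Icc 0 Real.pi))
    (hi : IntegrableOn (fun x => h x * (Real.sin x)⁻¹) (Ioo 0 Real.pi)) :
    h 0 = 0 ∧ h Real.pi = 0 := by
  refine ⟨eq_zero_of_integrableOn_mul_inv_sin hc hi, ?_⟩
  have := eq_zero_of_integrableOn_mul_inv_sin (h := fun x => h (Real.pi - x)) ?_ ?_
  · simpa using this
  · exact hc.comp (by fun_prop) fun x hx => ⟨by linarith [hx.2], by linarith [hx.1]⟩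
  · rw [← intervalIntegrable_iff_integrableOn_Ioo_of_le Real.pi_pos.le] at hi ⊢
    simpa using (hi.comp_sub_left Real.pi).symm

open Set in
/-- Sharp lower bound `∫ (f'² + f² / sin²) sin ≥ 2 ∫ f² sin`, from completing the square
`(f' - f cot)²`. -/
lemma two_mul_integral_sq_mul_sin_le {f : ℝ → ℝ}
    (hf : ContDiffOn ℝ 1 f (Ioo 0 Real.pi))
    (h1 : IntegrableOn (fun θ => f θ ^ 2 * Real.sin θ) (Ioo 0 Real.pi))
    (h2 : IntegrableOn (fun θ => deriv f θ ^ 2 * Real.sin θ) (Ioo 0 Real.pi))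
    (h3 : IntegrableOn (fun θ => f θ ^ 2 * (Real.sin θ)⁻¹) (Ioo 0 Real.pi)) :
    2 * ∫ θ in Ioo 0 Real.pi, f θ ^ 2 * Real.sin θ ≤
      ∫ θ in Ioo 0 Real.pi, (deriv f θ ^ 2 * Real.sin θ + f θ ^ 2 * (Real.sin θ)⁻¹) := by
  have hpi := Real.pi_pos
  have hd : ∀ x ∈ Ioo 0 Real.pi, HasDerivAt f (deriv f x) x := fun x hx =>
    ((hf.differentiableOn one_ne_zero).differentiableAt (isOpen_Ioo.mem_nhds hx)).hasDerivAt
  have hdc : ContinuousOn (deriv f) (Ioo 0 Real.pi) :=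
    hf.continuousOn_deriv_of_isOpen isOpen_Ioo le_rfl
  set p : ℝ → ℝ := fun x => 2 * f x * deriv f x with hp
  have hpc : ContinuousOn p (Ioo 0 Real.pi) := (continuousOn_const.mul hf.continuousOn).mul hdc
  have hpI : IntegrableOn p (Ioo 0 Real.pi) := by
    refine Integrable.mono' (h2.add h3) (hpc.aestronglyMeasurable measurableSet_Ioo) ?_
    refine (ae_restrict_mem measurableSet_Ioo).mono fun x hx => ?_
    have hs := Real.sin_pos_of_mem_Ioo hx
    simp only [Pi.add_apply, Real.norm_eq_abs, hp]
    have e1 : deriv f x ^ 2 * Real.sin x + f x ^ 2 * (Real.sin x)⁻¹ - 2 * f x * deriv f x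
        = (deriv f x * Real.sin x - f x) ^ 2 * (Real.sin x)⁻¹ := by field_simp; ring
    have e2 : deriv f x ^ 2 * Real.sin x + f x ^ 2 * (Real.sin x)⁻¹ + 2 * f x * deriv f x
        = (deriv f x * Real.sin x + f x) ^ 2 * (Real.sin x)⁻¹ := by field_simp; ring
    have p1 : 0 ≤ (deriv f x * Real.sin x - f x) ^ 2 * (Real.sin x)⁻¹ := by positivity
    have p2 : 0 ≤ (deriv f x * Real.sin x + f x) ^ 2 * (Real.sin x)⁻¹ := by positivity
    rw [abs_le]
    constructor <;> linarith
  have hpII : IntervalIntegrable p volume 0 Real.pi := by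
    rwa [intervalIntegrable_iff_integrableOn_Ioo_of_le hpi.le]
  have hmid : Real.pi / 2 ∈ Ioo 0 Real.pi := ⟨by linarith, by linarith⟩
  set H : ℝ → ℝ := fun x => f (Real.pi / 2) ^ 2 + ∫ t in (Real.pi / 2)..x, p t with hH
  have hHc : ContinuousOn H (Icc 0 Real.pi) := by
    refine continuousOn_const.add ?_
    have := intervalIntegral.continuousOn_primitive_interval' hpII
      (a := Real.pi / 2) (by rw [uIcc_of_le hpi.le]; exact Ioo_subset_Icc_self hmid)
    rwa [uIcc_of_le hpi.le] at this
  have hHf : ∀ x ∈ Ioo 0 Real.pi, H x = f x ^ 2 := by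
    intro x hx
    have hsub : uIcc (Real.pi / 2) x ⊆ Ioo 0 Real.pi := ordConnected_Ioo.uIcc_subset hmid hx
    have := intervalIntegral.integral_eq_sub_of_hasDerivAt (f := fun y => f y ^ 2) (f' := p)
      (a := Real.pi / 2) (b := x) (fun y hy => by simpa [hp] using (hd y (hsub hy)).fun_pow 2)
      ((hpc.mono hsub).intervalIntegrable)
    simp only [hH, this]
    ring
  have hHd : ∀ x ∈ Ioo 0 Real.pi, HasDerivAt H (p x) x := fun x hx => by
    have : HasDerivAt (fun y => f y ^ 2) (p x) x := by simpa [hp] using (hd x hx).fun_pow 2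
    exact this.congr_of_eventuallyEq
      (Filter.eventually_of_mem (isOpen_Ioo.mem_nhds hx) hHf)
  obtain ⟨hH0, hHpi⟩ := endpoints_eq_zero_of_integrableOn_mul_inv_sin hHc
    (h3.congr_fun (fun x hx => by simp only [hHf x hx]) measurableSet_Ioo)
  have hqI : IntegrableOn (fun x => p x * Real.cos x - f x ^ 2 * Real.sin x)
      (Ioo 0 Real.pi) := by
    refine Integrable.sub (Integrable.mono hpI ?_ ?_) h1
    · exact (hpc.mul Real.continuous_cos.continuousOn).aestronglyMeasurable measurableSet_Ioo
    · refine Filter.Eventually.of_forall fun x => ?_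
      rw [norm_mul]
      exact mul_le_of_le_one_right (norm_nonneg _) (Real.abs_cos_le_one x)
  have hq0 : ∫ x in Ioo 0 Real.pi, (p x * Real.cos x - f x ^ 2 * Real.sin x) = 0 := by
    rw [← integral_Ioc_eq_integral_Ioo, ← intervalIntegral.integral_of_le hpi.le,
      intervalIntegral.integral_eq_sub_of_hasDerivAt_of_le (f := fun x => H x * Real.cos x) hpi.le
        (hHc.mul Real.continuous_cos.continuousOn)]
    · simp [hH0, hHpi]
    · intro x hx
      refine ((hHd x hx).fun_mul (Real.hasDerivAt_cos x)).congr_deriv ?_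
      rw [hHf x hx]
      ring
    · rwa [intervalIntegrable_iff_integrableOn_Ioo_of_le hpi.le]
  calc 2 * ∫ θ in Ioo 0 Real.pi, f θ ^ 2 * Real.sin θ
      = ∫ θ in Ioo 0 Real.pi,
          (2 * (f θ ^ 2 * Real.sin θ) + (p θ * Real.cos θ - f θ ^ 2 * Real.sin θ)) := by
        rw [integral_add (h1.const_mul 2) hqI, integral_const_mul, hq0, add_zero]
    _ ≤ _ := by
        refine setIntegral_mono_on ((h1.const_mul 2).add hqI) (h2.add h3) measurableSet_Ioo
          fun x hx => ?_
        have hs := Real.sin_pos_of_mem_Ioo hx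
        have e : deriv f x ^ 2 * Real.sin x + f x ^ 2 * (Real.sin x)⁻¹
            - (2 * (f x ^ 2 * Real.sin x) + (p x * Real.cos x - f x ^ 2 * Real.sin x))
            = (deriv f x * Real.sin x - f x * Real.cos x) ^ 2 * (Real.sin x)⁻¹ := by
          simp only [hp]
          field_simp
          linear_combination (-f x ^ 2) * Real.sin_sq_add_cos_sq x
        have : 0 ≤ (deriv f x * Real.sin x - f x * Real.cos x) ^ 2 * (Real.sin x)⁻¹ := by
          positivity
        linarith

open Set in
lemma two_le_of_mem_RayleighSet {m : ℤ} (hm : |m| = 1) {R : ℝ} (hR : R ∈ RayleighSet m) :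
    2 ≤ R := by
  obtain ⟨f, hf, h1, h2, h3, hne, rfl⟩ := hR
  have hm2 : (m : ℝ) ^ 2 = 1 := by
    rw [← sq_abs, ← Int.cast_abs, hm]; norm_num
  have hnn : ∀ x ∈ Ioo 0 Real.pi, 0 ≤ f x ^ 2 * Real.sin x := fun x hx =>
    mul_nonneg (sq_nonneg _) (Real.sin_pos_of_mem_Ioo hx).le
  have hnn' := (ae_restrict_mem (μ := volume) measurableSet_Ioo).mono hnn
  have hpos : 0 < ∫ θ in Ioo 0 Real.pi, f θ ^ 2 * Real.sin θ := by
    refine lt_of_le_of_ne (integral_nonneg_of_ae hnn') fun h0 => hne ?_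
    have := (integral_eq_zero_iff_of_nonneg_ae hnn' h1).mp h0.symm
    filter_upwards [this, ae_restrict_mem measurableSet_Ioo] with x hx hxm
    have hs := Real.sin_pos_of_mem_Ioo hxm
    simpa [hs.ne'] using hx
  rw [le_div_iff₀ hpos]
  refine (two_mul_integral_sq_mul_sin_le hf h1 h2 h3).trans ?_
  have h4 : IntegrableOn (fun θ => 1 / 4 * (f θ ^ 2 * Real.sin θ) * Real.sin θ ^ 2)
      (Ioo 0 Real.pi) := by
    refine Integrable.mono (h1.const_mul (1 / 4)) ?_ ?_
    · exact ((h1.const_mul (1 / 4)).aestronglyMeasurable).mul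
        (Real.continuous_sin.pow 2).aestronglyMeasurable
    · refine Filter.Eventually.of_forall fun x => ?_
      rw [norm_mul]
      refine mul_le_of_le_one_right (norm_nonneg _) ?_
      rw [Real.norm_of_nonneg (sq_nonneg _)]
      exact Real.sin_sq_le_one x
  have hN : EqOn (fun θ => (deriv f θ ^ 2 +
      (m : ℝ) ^ 2 * ((Real.sin θ ^ 2)⁻¹ + 1 / 4 * Real.sin θ ^ 2) * f θ ^ 2) * Real.sin θ)
      (fun θ => (deriv f θ ^ 2 * Real.sin θ + f θ ^ 2 * (Real.sin θ)⁻¹) +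
        1 / 4 * (f θ ^ 2 * Real.sin θ) * Real.sin θ ^ 2) (Ioo 0 Real.pi) := fun x hx => by
    have hs := Real.sin_pos_of_mem_Ioo hx
    simp only [hm2]
    field_simp
    ring
  rw [setIntegral_congr_fun measurableSet_Ioo hN]
  refine setIntegral_mono_on (h2.add h3) ((h2.add h3).add h4) measurableSet_Ioo fun x hx => ?_
  have := hnn x hx
  have : 0 ≤ 1 / 4 * (f x ^ 2 * Real.sin x) * Real.sin x ^ 2 := by positivity
  linarith

lemma bddBelow_RayleighSet (m : ℤ) : BddBelow (RayleighSet m) := by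
  refine ⟨0, ?_⟩
  rintro _ ⟨f, -, -, -, -, -, rfl⟩
  refine div_nonneg ?_ ?_ <;>
  · refine setIntegral_nonneg measurableSet_Ioo fun x hx => ?_
    have := Real.sin_pos_of_mem_Ioo hx
    positivity

lemma integral_sin_pow_add_two (n : ℕ) :
    ∫ x in (0 : ℝ)..Real.pi, Real.sin x ^ (n + 2) =
      (n + 1) / (n + 2) * ∫ x in (0 : ℝ)..Real.pi, Real.sin x ^ n := by
  simp [integral_sin_pow]

open Set in
/-- The Rayleigh quotient of the test function `sin ^ |m|`. -/
lemma rayleigh_sin_pow_mem {m : ℤ} {k : ℕ} (hk : m.natAbs = k + 1) :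
    ((k : ℝ) + 1) ^ 2 + (k + 1) + (k + 1) ^ 2 * (k + 2) / (2 * (2 * k + 5)) ∈ RayleighSet m := by
  have hm2 : (m : ℝ) ^ 2 = (k + 1) ^ 2 := by
    rw [← sq_abs, ← Int.cast_abs, Int.abs_eq_natAbs, hk]; push_cast; rfl
  have hder : ∀ x, deriv (fun θ => Real.sin θ ^ (k + 1)) x
      = (k + 1) * Real.sin x ^ k * Real.cos x := fun x => by
    simp
  have hcont : ∀ {g : ℝ → ℝ}, Continuous g → IntegrableOn g (Ioo 0 Real.pi) := fun hg =>
    (hg.integrableOn_Icc (a := 0) (b := Real.pi)).mono_set Ioo_subset_Icc_self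
  refine ⟨fun θ => Real.sin θ ^ (k + 1), ?_, ?_, ?_, ?_, ?_, ?_⟩
  · exact (Real.contDiff_sin.pow _).contDiffOn
  · exact hcont (by fun_prop)
  · simp only [hder]
    exact hcont (by fun_prop)
  · refine (hcont (g := fun θ => Real.sin θ ^ (2 * k + 1)) (by fun_prop)).congr_fun
      (fun x hx => ?_) measurableSet_Ioo
    have hs := Real.sin_pos_of_mem_Ioo hx
    field_simp
    ring
  · intro h
    have hF : ∀ᵐ θ ∂(volume.restrict (Ioo 0 Real.pi)), False := by
      filter_upwards [h, ae_restrict_mem measurableSet_Ioo] with x hx hxm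
      exact (pow_pos (Real.sin_pos_of_mem_Ioo hxm) _).ne' hx
    have hv := ae_restrict_iff' (measurableSet_Ioo (α := ℝ)) |>.mp hF
    have hv0 : volume (Ioo 0 Real.pi) = 0 := by
      simpa [ae_iff, Ioo] using hv
    simp [Real.pi_pos.not_ge] at hv0
  · set I : ℕ → ℝ := fun n => ∫ x in (0 : ℝ)..Real.pi, Real.sin x ^ n with hI
    have hconv : ∀ g : ℝ → ℝ, ∫ x in Ioo 0 Real.pi, g x = ∫ x in (0 : ℝ)..Real.pi, g x :=
      fun g => by
        rw [← integral_Ioc_eq_integral_Ioo, ← intervalIntegral.integral_of_le Real.pi_pos.le]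
    have hden : ∫ θ in Ioo 0 Real.pi, (Real.sin θ ^ (k + 1)) ^ 2 * Real.sin θ
        = I (2 * k + 3) := by
      rw [hconv]
      exact intervalIntegral.integral_congr fun x _ => by ring
    have hnum : ∫ θ in Ioo 0 Real.pi, (deriv (fun θ => Real.sin θ ^ (k + 1)) θ ^ 2 +
          (m : ℝ) ^ 2 * ((Real.sin θ ^ 2)⁻¹ + 1 / 4 * Real.sin θ ^ 2) *
            (Real.sin θ ^ (k + 1)) ^ 2) * Real.sin θ
        = (k + 1) ^ 2 * (2 * I (2 * k + 1) - I (2 * k + 3) + 1 / 4 * I (2 * k + 5)) := by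
      have hE : EqOn (fun θ => (deriv (fun θ => Real.sin θ ^ (k + 1)) θ ^ 2 +
          (m : ℝ) ^ 2 * ((Real.sin θ ^ 2)⁻¹ + 1 / 4 * Real.sin θ ^ 2) *
            (Real.sin θ ^ (k + 1)) ^ 2) * Real.sin θ)
          (fun θ => ((k : ℝ) + 1) ^ 2 * (2 * Real.sin θ ^ (2 * k + 1) - Real.sin θ ^ (2 * k + 3)
            + 1 / 4 * Real.sin θ ^ (2 * k + 5))) (Ioo 0 Real.pi) := fun x hx => by
        have hs := Real.sin_pos_of_mem_Ioo hx
        simp only [hder, hm2, mul_pow, Real.cos_sq']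
        field_simp
        ring
      have hii : ∀ n : ℕ, IntervalIntegrable (fun x => Real.sin x ^ n) volume 0 Real.pi :=
        fun n => (Real.continuous_sin.pow n).intervalIntegrable _ _
      rw [setIntegral_congr_fun measurableSet_Ioo hE, hconv, intervalIntegral.integral_const_mul,
        intervalIntegral.integral_add (((hii _).const_mul 2).sub (hii _)) ((hii _).const_mul _),
        intervalIntegral.integral_sub ((hii _).const_mul 2) (hii _),
        intervalIntegral.integral_const_mul, intervalIntegral.integral_const_mul]
    rw [hden, hnum]
    have hpos : 0 < I (2 * k + 1) := integral_sin_pow_pos _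
    have r1 : I (2 * k + 3) = (2 * k + 2) / (2 * k + 3) * I (2 * k + 1) := by
      have := integral_sin_pow_add_two (2 * k + 1)
      push_cast at this
      simp only [hI]
      rw [this]
      ring
    have r2 : I (2 * k + 5) = (2 * k + 4) / (2 * k + 5) * I (2 * k + 3) := by
      have := integral_sin_pow_add_two (2 * k + 3)
      push_cast at this
      simp only [hI]
      rw [this]
      ring
    rw [r2, r1]
    field_simp
    ring

/-- Lemma 2.2: (a) if `|m| = 1` then `α_m ≥ ¼` (equivalently `Λ_m ≥ 2`);
(b) if `|m| ≥ 2` then `Λ_m ≤ (17/10)m² + ½`, hence `α_m ≤ −(9/80)m² < 0`. -/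
theorem alphaM_sign (m : ℤ) (hm : m ≠ 0) :
    (|m| = 1 → 1 / 4 ≤ alphaM m ∧ 2 ≤ LambdaM m) ∧
    (2 ≤ |m| → LambdaM m ≤ 17 / 10 * (m : ℝ) ^ 2 + 1 / 2 ∧
      alphaM m ≤ -(9 / 80) * (m : ℝ) ^ 2 ∧ alphaM m < 0) := by
  obtain ⟨k, hk⟩ := Nat.exists_eq_succ_of_ne_zero (Int.natAbs_ne_zero.mpr hm)
  have hmem := rayleigh_sin_pow_mem hk
  have hm2 : (m : ℝ) ^ 2 = (k + 1) ^ 2 := by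
    rw [← sq_abs, ← Int.cast_abs, Int.abs_eq_natAbs, hk]; push_cast; rfl
  refine ⟨fun h => ?_, fun h => ?_⟩
  · have hL : 2 ≤ LambdaM m := le_csInf ⟨_, hmem⟩ fun R hR => two_le_of_mem_RayleighSet h hR
    have h1 : (m : ℝ) ^ 2 = 1 := by rw [← sq_abs, ← Int.cast_abs, h]; norm_num
    refine ⟨?_, hL⟩
    rw [alphaM, h1]
    linarith
  · have hk1 : (1 : ℝ) ≤ k := by
      have : 1 ≤ k := by rw [Int.abs_eq_natAbs, hk] at h; omega
      exact_mod_cast this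
    have hL : LambdaM m ≤ 17 / 10 * (m : ℝ) ^ 2 + 1 / 2 := by
      refine (csInf_le (bddBelow_RayleighSet m) hmem).trans ?_
      have : ((k : ℝ) + 1) ^ 2 * (k + 2) / (2 * (2 * k + 5)) ≤ (k + 1) ^ 2 / 4 := by
        rw [div_le_div_iff₀ (by positivity) (by positivity)]
        nlinarith [sq_nonneg ((k : ℝ) + 1)]
      rw [hm2]
      nlinarith
    have hα : alphaM m ≤ -(9 / 80) * (m : ℝ) ^ 2 := by
      rw [alphaM]
      nlinarith
    refine ⟨hL, hα, hα.trans_lt ?_⟩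
    rw [hm2]
    nlinarith
end
end

section
/- Fix p∈(0,2], δ≥0 and r_H∈(1,2]. Then there exists C>0 with the following property. Let U:ℝ×ℝ³→ℂ be smooth and compactly supported with support contained in {r>1}, define u(r,θ,φ):=U(r,(sinθcosφ, sinθ sinφ, cosθ)), and assume ∫₀^{2π} u(r,θ,φ)dφ = 0 for all (r,θ) (u supported on nonzero azimuthal modes, as for a fixed azimuthal mode with |m|≥1). Set ũ:=√(r²−1)·u. Then for every ε∈(0,1]: ∫_Σ [ p r^{p−1}(1−r⁻¹)² |∂_r ũ|² + (2−p) r^{p−3}( |∂_θ ũ|² + ((sinθ)⁻²+¼ sin²θ)|∂_φ ũ|² ) ] dσ dr ≤ ε ∫_{Σ∩{r≤r_H}} (1−r⁻¹)^{1+δ} |∂_r ũ|² dσ dr + C ε⁻¹ ∫_Σ r^{p−1}(1−r⁻¹)^{−δ} |ℒu|² dσ dr, where the integrals are over Σ=(1,∞)×(0,π)×(0,2π) with dσ=sinθ dθ dφ, and ℒu := ∂_r((r−1)²∂_r u) − (r²−1)∂_r∂_φ u − r∂_φ u + (sinθ)⁻¹∂_θ(sinθ ∂_θ u) + (sinθ)⁻²∂²_φ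 u + ¼ sin²θ ∂²_φ u − ∂²_φ u. (This is the global degenerate elliptic estimate of Proposition 9.1 for the extremal-Kerr K-inversion operator.) -/
noncomputable section

open MeasureTheory

/-- The function on `(r,θ,φ)` induced by `U : ℝ × ℝ³ → ℂ` via spherical coordinates on
the second factor: `u(r,θ,φ) = U(r, (sinθcosφ, sinθsinφ, cosθ))`. -/
def usph (U : ℝ × (Fin 3 → ℝ) → ℂ) (r θ φ : ℝ) : ℂ :=
  U (r, ![Real.sin θ * Real.cos φ, Real.sin θ * Real.sin φ, Real.cos θ])

/-- `ũ = √(r²−1)·u`. -/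
def utld (U : ℝ × (Fin 3 → ℝ) → ℂ) (r θ φ : ℝ) : ℂ :=
  (Real.sqrt (r ^ 2 - 1) : ℂ) * usph U r θ φ

/-- Partial derivatives in `r`, `θ`, `φ`. -/
def dR (f : ℝ → ℝ → ℝ → ℂ) (r θ φ : ℝ) : ℂ := deriv (fun s => f s θ φ) r
def dTh (f : ℝ → ℝ → ℝ → ℂ) (r θ φ : ℝ) : ℂ := deriv (fun t => f r t φ) θ
def dPh (f : ℝ → ℝ → ℝ → ℂ) (r θ φ : ℝ) : ℂ := deriv (fun q => f r θ q) φ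

/-- The extremal-Kerr K-inversion operator (normalized `a = M = r₊ = 1`, `aω₊ = 1/2`):
`ℒu = ∂_r((r−1)²∂_ru) − (r²−1)∂_r∂_φu − r∂_φu + (sinθ)⁻¹∂_θ(sinθ∂_θu)
+ (sinθ)⁻²∂²_φu + ¼sin²θ∂²_φu − ∂²_φu`. -/
def Lell (U : ℝ × (Fin 3 → ℝ) → ℂ) (r θ φ : ℝ) : ℂ :=
  deriv (fun s => (((s - 1) ^ 2 : ℝ) : ℂ) * dR (usph U) s θ φ) r
    - ((r ^ 2 - 1 : ℝ) : ℂ) * deriv (fun s => dPh (usph U) s θ φ) r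
    - (r : ℂ) * dPh (usph U) r θ φ
    + ((Real.sin θ : ℝ) : ℂ)⁻¹ *
        deriv (fun t => ((Real.sin t : ℝ) : ℂ) * dTh (usph U) r t φ) θ
    + ((Real.sin θ ^ 2 : ℝ) : ℂ)⁻¹ * deriv (fun q => dPh (usph U) r θ q) φ
    + ((1 / 4 * Real.sin θ ^ 2 : ℝ) : ℂ) * deriv (fun q => dPh (usph U) r θ q) φ
    - deriv (fun q => dPh (usph U) r θ q) φ


/-- The radial multiplier weight. -/
def multW (p r : ℝ) : ℝ := (r + 1) ^ (p - 2) + 600 * (r + 1) ^ (p / 200 - 2)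

/-- The radial derivative of `multW`. -/
def multW' (p r : ℝ) : ℝ :=
  (p - 2) * (r + 1) ^ (p - 3) + 600 * ((p / 200 - 2) * (r + 1) ^ (p / 200 - 3))

lemma hasDerivAt_multW (p : ℝ) {r : ℝ} (hr : 1 < r) :
    HasDerivAt (multW p) (multW' p r) r := by
  have hx : HasDerivAt (fun s : ℝ => s + 1) 1 r := (hasDerivAt_id r).add_const 1
  have key : ∀ e : ℝ, HasDerivAt (fun s : ℝ => (s + 1) ^ (e - 2)) ((e - 2) * (r + 1) ^ (e - 3)) r := by
    intro e
    have := hx.rpow_const (p := e - 2) (Or.inl (by linarith))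
    convert this using 1
    rw [show e - 2 - 1 = e - 3 by ring]; ring
  exact (key p).add ((key (p / 200)).const_mul 600)

lemma rpow_sub_two {x : ℝ} (hx : 0 < x) (e : ℝ) : x ^ (e - 2) = x * x ^ (e - 3) := by
  rw [show e - 2 = 1 + (e - 3) by ring, Real.rpow_add hx, Real.rpow_one]

lemma multiplier_coercive {p r N A Z : ℝ} (hp0 : 0 < p) (hp2 : p ≤ 2) (hr : 1 < r) (hN : 0 ≤ N)
    (hZ : 0 ≤ Z) (hA : Z ≤ 160 * A) :
    (r + 1) ^ (p - 3) * (p * (r - 1) ^ 2 * N + (2 - p) * A) ≤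
      multW' p r * ((r - 1) ^ 2 * N - A - (2 * r - 1) / (r + 1) ^ 2 * Z)
        + multW p r * ((2 * (r - 1) - 4 * (r - 1) / (r + 1)) * N
          - (4 - 2 * r) / (r + 1) ^ 3 * Z) := by
  have hx : 0 < r + 1 := by linarith
  unfold multW multW'
  rw [rpow_sub_two hx p, rpow_sub_two hx (p / 200)]
  set α := (r + 1) ^ (p - 3) with hα
  set β := (r + 1) ^ (p / 200 - 3) with hβ
  have hα0 : 0 < α := Real.rpow_pos_of_pos hx _
  have hβ0 : 0 < β := Real.rpow_pos_of_pos hx _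
  set c := (2 * r - 1) / (r + 1) ^ 2 with hc
  set d := (4 - 2 * r) / (r + 1) ^ 2 with hd
  have hc0 : 0 ≤ c := by apply div_nonneg <;> nlinarith
  have hc1 : c ≤ 1 / 3 := by
    rw [hc, div_le_iff₀ (by positivity)]; nlinarith [sq_nonneg (r - 2)]
  have hcd : d ≤ 2 * c := by
    rw [hc, hd, ← mul_div_assoc]; apply div_le_div_of_nonneg_right _ (by positivity); linarith
  have e1 : (2 * (r - 1) - 4 * (r - 1) / (r + 1)) = 2 * (r - 1) ^ 2 / (r + 1) := by
    field_simp; ring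
  have e2 : (4 - 2 * r) / (r + 1) ^ 3 = d / (r + 1) := by
    rw [hd]; field_simp
  rw [e1, e2]
  have hzero : 0 ≤ (2 - p) * c * α + 600 * β * ((2 - p / 200) * (1 / 160 + c) - d) - α * d := by
    have h0 : 0 ≤ (2 - p) * c * α := by
      apply mul_nonneg (mul_nonneg (by linarith) hc0) hα0.le
    have h1 : 1 / 125 ≤ (2 - p / 200) * (1 / 160 + c) - d := by nlinarith
    rcases le_or_gt 2 r with h2 | h2
    · have hd0 : d ≤ 0 := by
        rw [hd]; apply div_nonpos_of_nonpos_of_nonneg <;> nlinarith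
      nlinarith [mul_nonneg hβ0.le (sub_nonneg.2 h1), mul_nonneg hα0.le (neg_nonneg.2 hd0)]
    · have hd1 : d ≤ 1 / 2 := by
        rw [hd, div_le_iff₀ (by positivity)]; nlinarith
      have hαβ : α ≤ 9 * β := by
        have : α = (r + 1) ^ (p - p / 200) * β := by
          rw [hα, hβ, ← Real.rpow_add hx]; ring_nf
        rw [this]
        apply mul_le_mul_of_nonneg_right _ hβ0.le
        calc (r + 1) ^ (p - p / 200) ≤ (r + 1) ^ (2 : ℝ) :=
              Real.rpow_le_rpow_of_exponent_le (by linarith) (by linarith)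
          _ = (r + 1) ^ 2 := by norm_cast
          _ ≤ 9 := by nlinarith
      nlinarith [mul_nonneg hβ0.le (sub_nonneg.2 h1), mul_nonneg hα0.le (sub_nonneg.2 hd1)]
  have hN' : 0 ≤ β * (p * (r - 1) ^ 2 * N) := by positivity
  have hA' : 0 ≤ (2 - p / 200) * β * (160 * A - Z) :=
    mul_nonneg (mul_nonneg (by linarith) hβ0.le) (by linarith)
  have hZ' := mul_nonneg hzero hZ
  have e3 : ((p - 2) * α + 600 * ((p / 200 - 2) * β)) * ((r - 1) ^ 2 * N - A - c * Z)
      + ((r + 1) * α + 600 * ((r + 1) * β)) * (2 * (r - 1) ^ 2 / (r + 1) * N - d / (r + 1) * Z)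
      = α * (p * (r - 1) ^ 2 * N + (2 - p) * A) + 3 * (β * (p * (r - 1) ^ 2 * N))
        + 600 / 160 * ((2 - p / 200) * β * (160 * A - Z))
        + ((2 - p) * c * α + 600 * β * ((2 - p / 200) * (1 / 160 + c) - d) - α * d) * Z := by
    field_simp; ring
  rw [e3]
  linarith

lemma rpow_sub_three_le {p r : ℝ} (hp0 : 0 < p) (hp2 : p ≤ 2) (hr : 1 < r) :
    r ^ (p - 3) ≤ 8 * (r + 1) ^ (p - 3) := by
  have hr0 : 0 < r := by linarith
  have h1 : (2 * r) ^ (p - 3) ≤ (r + 1) ^ (p - 3) :=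
    Real.rpow_le_rpow_of_nonpos (by linarith) (by linarith) (by linarith)
  rw [Real.mul_rpow (by norm_num) hr0.le] at h1
  have h3 : (1 / 8 : ℝ) ≤ 2 ^ (p - 3) := by
    calc (1 / 8 : ℝ) = 2 ^ (-3 : ℝ) := by rw [Real.rpow_neg (by norm_num)]; norm_num
      _ ≤ 2 ^ (p - 3) := Real.rpow_le_rpow_of_exponent_le (by norm_num) (by linarith)
  have := mul_le_mul_of_nonneg_right h3 (Real.rpow_pos_of_pos hr0 (p - 3)).le
  linarith

lemma multW_pos (p : ℝ) {r : ℝ} (hr : 1 < r) : 0 < multW p r := by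
  have hx : 0 < r + 1 := by linarith
  unfold multW; positivity

lemma multW_sq_mul_le {p r : ℝ} (hp0 : 0 < p) (hp2 : p ≤ 2) (hr : 1 < r) :
    multW p r ^ 2 * r ^ 2 ≤ 601 ^ 2 * (r ^ (p - 1)) ^ 2 := by
  have hr0 : 0 < r := by linarith
  have h1 : (r + 1) ^ (p / 200 - 2) ≤ (r + 1) ^ (p - 2) :=
    Real.rpow_le_rpow_of_exponent_le (by linarith) (by linarith)
  have h2 : (r + 1) ^ (p - 2) ≤ r ^ (p - 2) :=
    Real.rpow_le_rpow_of_nonpos hr0 (by linarith) (by linarith)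
  have hm1 : multW p r ≤ 601 * r ^ (p - 2) := by unfold multW; linarith
  have e : r ^ (p - 1) = r ^ (p - 2) * r := by
    rw [show p - 1 = (p - 2) + 1 by ring, Real.rpow_add hr0, Real.rpow_one]
  have := mul_le_mul_of_nonneg_right (pow_le_pow_left₀ (multW_pos p hr).le hm1 2) (sq_nonneg r)
  rw [e]
  linarith

lemma weighted_energy_le {p r N A D : ℝ} (hp0 : 0 < p) (hp2 : p ≤ 2) (hr : 1 < r) (hN : 0 ≤ N)
    (hA : 0 ≤ A) (hDA : D ≤ 5 * A) :
    p * r ^ (p - 1) * (1 - r⁻¹) ^ 2 * N + (2 - p) * r ^ (p - 3) * D ≤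
      40 * ((r + 1) ^ (p - 3) * (p * (r - 1) ^ 2 * N + (2 - p) * A)) := by
  have hr0 : 0 < r := by linarith
  have hr1 : r ^ (p - 1) = r ^ 2 * r ^ (p - 3) := by
    rw [show p - 1 = 2 + (p - 3) by ring, Real.rpow_add hr0]; norm_cast
  have e : p * r ^ (p - 1) * (1 - r⁻¹) ^ 2 * N + (2 - p) * r ^ (p - 3) * D
      = r ^ (p - 3) * (p * (r - 1) ^ 2 * N + (2 - p) * D) := by
    rw [hr1]; field_simp
  have hn : 0 ≤ p * (r - 1) ^ 2 * N := by positivity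
  have hn2 : 0 ≤ (2 - p) * A := mul_nonneg (by linarith) hA
  have hn3 : (2 - p) * D ≤ (2 - p) * (5 * A) := mul_le_mul_of_nonneg_left hDA (by linarith)
  rw [e]
  calc r ^ (p - 3) * (p * (r - 1) ^ 2 * N + (2 - p) * D)
      ≤ r ^ (p - 3) * (5 * (p * (r - 1) ^ 2 * N + (2 - p) * A)) :=
        mul_le_mul_of_nonneg_left (by linarith) (by positivity)
    _ ≤ 8 * (r + 1) ^ (p - 3) * (5 * (p * (r - 1) ^ 2 * N + (2 - p) * A)) :=
        mul_le_mul_of_nonneg_right (rpow_sub_three_le hp0 hp2 hr) (by positivity)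
    _ = _ := by ring

set_option maxHeartbeats 600000 in
/-- Pointwise-in-`r` form of the radial estimate, before integrating the total derivative `T`. -/
lemma radial_pointwise {p δ rH : ℝ} (hp0 : 0 < p) (hp2 : p ≤ 2) (hδ : 0 ≤ δ) (hrH1 : 1 < rH)
    (hrH2 : rH ≤ 2) :
    ∃ C > 0, ∀ {r ε N A D Z R Y T : ℝ}, 1 < r → 0 < ε → ε ≤ 1 → 0 ≤ N → 0 ≤ Z → 0 ≤ Y → 0 ≤ D →
      Z ≤ 160 * A → D ≤ 5 * A → (∀ t > 0, -R ≤ t * N + (r ^ 2 - 1) * Y / t) →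
      T = multW' p r * ((r - 1) ^ 2 * N - A - (2 * r - 1) / (r + 1) ^ 2 * Z)
        + multW p r * ((2 * (r - 1) - 4 * (r - 1) / (r + 1)) * N
          - (4 - 2 * r) / (r + 1) ^ 3 * Z) + multW p r * R →
      p * r ^ (p - 1) * (1 - r⁻¹) ^ 2 * N + (2 - p) * r ^ (p - 3) * D ≤
        80 * T + ε * (if r ≤ rH then (1 - r⁻¹) ^ (1 + δ) * N else 0)
          + C * ε⁻¹ * (r ^ (p - 1) * (1 - r⁻¹) ^ (-δ) * Y) := by
  have hyH : 0 < 1 - rH⁻¹ := sub_pos.2 (inv_lt_one_of_one_lt₀ hrH1)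
  set C1 : ℝ := 8 * 24040 ^ 2 with hC1
  set C2 : ℝ := 4 * 24040 ^ 2 / (p * (1 - rH⁻¹) ^ 2) with hC2
  have hC1pos : 0 < C1 := by positivity
  have hC2pos : 0 < C2 := by positivity
  refine ⟨2 * (C1 + C2), by positivity, ?_⟩
  intro r ε N A D Z R Y T hr hε hε1 hN hZ hY hD hZA hDA hR hT
  have hr0 : 0 < r := by linarith
  have hA0 : 0 ≤ A := by linarith
  have hL1 := (weighted_energy_le hp0 hp2 hr hN hA0 hDA).trans
    (mul_le_mul_of_nonneg_left (multiplier_coercive hp0 hp2 hr hN hZ hZA) (by norm_num : (0 : ℝ) ≤ 40))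
  have hDn : 0 ≤ (2 - p) * r ^ (p - 3) * D :=
    mul_nonneg (mul_nonneg (by linarith) (by positivity)) hD
  have hm0 := multW_pos p hr
  have hm2 := multW_sq_mul_le hp0 hp2 hr
  set y := 1 - r⁻¹ with hy
  have hy0 : 0 < y := sub_pos.2 (inv_lt_one_of_one_lt₀ hr)
  have hy1 : y ≤ 1 := by rw [hy]; linarith [inv_pos.2 hr0]
  have hry : r * y = r - 1 := by rw [hy]; field_simp
  have hG : 0 < r ^ 2 - 1 := by nlinarith
  have hG2 : r ^ 2 - 1 ≤ 2 * r ^ 2 * y := by nlinarith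
  have hw0 : 0 < r ^ (p - 1) := Real.rpow_pos_of_pos hr0 _
  have hyd : 1 ≤ y ^ (-δ) := Real.one_le_rpow_of_pos_of_le_one_of_nonpos hy0 hy1 (by linarith)
  set L := p * r ^ (p - 1) * y ^ 2 * N + (2 - p) * r ^ (p - 3) * D with hL
  set w := r ^ (p - 1) with hw
  set m := multW p r with hm
  have hL2 : ∀ s > 0, L ≤ 40 * T + s * N + 1600 * m ^ 2 * (r ^ 2 - 1) / s * Y := by
    intro s hs
    have h2 := mul_le_mul_of_nonneg_left (hR (s / (40 * m)) (by positivity)) hm0.le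
    have e : 40 * (m * (s / (40 * m) * N + (r ^ 2 - 1) * Y / (s / (40 * m))))
      = s * N + 1600 * m ^ 2 * (r ^ 2 - 1) / s * Y := by field_simp; ring
    linarith
  have hεi : 1 ≤ ε⁻¹ := (one_le_inv₀ hε).2 hε1
  have hQ : 0 ≤ w * y ^ (-δ) * Y := by positivity
  have hM : 1600 * m ^ 2 * (r ^ 2 - 1) ≤ 2 * 24040 ^ 2 * w ^ 2 * y := by
    have := mul_le_mul_of_nonneg_left hG2 (by positivity : 0 ≤ 1600 * m ^ 2)
    have := mul_le_mul_of_nonneg_right hm2 (by positivity : 0 ≤ 3200 * y)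
    linarith
  split_ifs with hrr
  · have hs : 0 < ε / 2 * y ^ (1 + δ) := by positivity
    have key : 1600 * m ^ 2 * (r ^ 2 - 1) / (ε / 2 * y ^ (1 + δ)) ≤ C1 * ε⁻¹ * (w * y ^ (-δ)) := by
      have hw2 : w ≤ 2 := by
        calc w ≤ r ^ (1 : ℝ) := Real.rpow_le_rpow_of_exponent_le hr.le (by linarith)
          _ ≤ 2 := by rw [Real.rpow_one]; linarith
      have e : y ^ (-δ) * y ^ (1 + δ) = y := by
        rw [← Real.rpow_add hy0]; simp
      rw [div_le_iff₀ hs]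
      have e2 : C1 * ε⁻¹ * (w * y ^ (-δ)) * (ε / 2 * y ^ (1 + δ)) =
          C1 / 2 * w * (y ^ (-δ) * y ^ (1 + δ)) := by
        field_simp
      rw [e2, e]
      have := mul_le_mul_of_nonneg_right hw2 (by positivity : 0 ≤ 2 * 24040 ^ 2 * w * y)
      rw [hC1]
      linarith
    have h1 := hL2 _ hs
    have h2 := mul_le_mul_of_nonneg_right key hY
    have h3 : 0 ≤ C2 * ε⁻¹ * (w * y ^ (-δ) * Y) := by positivity
    have h4 : 0 ≤ L := by positivity
    have h5 : 0 ≤ C1 * ε⁻¹ * (w * y ^ (-δ) * Y) := by positivity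
    linarith
  · have hs : 0 < p / 2 * w * y ^ 2 := by positivity
    have hyy : 1 - rH⁻¹ ≤ y := by
      have := inv_anti₀ (by linarith : 0 < rH) (not_le.1 hrr).le
      linarith
    have key : 1600 * m ^ 2 * (r ^ 2 - 1) / (p / 2 * w * y ^ 2) ≤ C2 * w := by
      have e : 1600 * m ^ 2 * (r ^ 2 - 1) / (p / 2 * w * y ^ 2) ≤
          2 * 24040 ^ 2 * w ^ 2 / (p / 2 * w * y ^ 2) := by
        apply div_le_div_of_nonneg_right _ hs.le
        exact hM.trans (mul_le_of_le_one_right (by positivity) hy1)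
      refine e.trans ?_
      have e2 : 2 * 24040 ^ 2 * w ^ 2 / (p / 2 * w * y ^ 2) = 4 * 24040 ^ 2 / (p * y ^ 2) * w := by
        field_simp; ring
      rw [e2, hC2]
      gcongr
    have h1 := hL2 _ hs
    have h2 := mul_le_mul_of_nonneg_right key hY
    have h3 : C2 * w * Y ≤ C2 * ε⁻¹ * (w * y ^ (-δ) * Y) := by
      have a1 : 1 ≤ ε⁻¹ * y ^ (-δ) := one_le_mul_of_one_le_of_one_le hεi hyd
      have := mul_le_mul_of_nonneg_right a1 (by positivity : 0 ≤ C2 * w * Y)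
      linarith
    have h5 : 0 ≤ C1 * ε⁻¹ * (w * y ^ (-δ) * Y) := by positivity
    linarith

lemma integrableOn_Ioi_of_eq_zero {f : ℝ → ℝ} {a b : ℝ} (ha : 1 < a)
    (hf : ContinuousOn f (Set.Ioi 1)) (h0 : ∀ r, 1 < r → r ∉ Set.Ioo a b → f r = 0) :
    IntegrableOn f (Set.Ioi 1) := by
  have hsub : Set.Icc a b ⊆ Set.Ioi 1 := fun r hr => lt_of_lt_of_le ha hr.1
  refine IntegrableOn.of_forall_sdiff_eq_zero
    ((hf.mono hsub).integrableOn_compact isCompact_Icc) measurableSet_Ioi fun r hr => ?_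
  exact h0 r hr.1 fun h => hr.2 (Set.Ioo_subset_Icc_self h)

lemma setIntegral_Ioi_deriv_eq_zero {P T : ℝ → ℝ} {a b : ℝ} (ha : 1 < a) (hab : a < b)
    (hT : ContinuousOn T (Set.Ioi 1)) (hd : ∀ r, 1 < r → HasDerivAt P (T r) r)
    (hT0 : ∀ r, 1 < r → r ∉ Set.Ioo a b → T r = 0) (hPa : P a = 0) (hPb : P b = 0) :
    ∫ r in Set.Ioi (1 : ℝ), T r = 0 := by
  have hsub : Set.Icc a b ⊆ Set.Ioi 1 := fun r hr => lt_of_lt_of_le ha hr.1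
  rw [setIntegral_eq_of_subset_of_forall_sdiff_eq_zero measurableSet_Ioi
    (Set.Ioc_subset_Icc_self.trans hsub) fun r hr => hT0 r hr.1 fun h =>
      hr.2 (Set.Ioo_subset_Ioc_self h), ← intervalIntegral.integral_of_le hab.le,
    intervalIntegral.integral_eq_sub_of_hasDerivAt (f := P), hPa, hPb, sub_self]
  · intro r hr
    rw [Set.uIcc_of_le hab.le] at hr
    exact hd r (hsub hr)
  · refine ContinuousOn.intervalIntegrable ?_
    rw [Set.uIcc_of_le hab.le]
    exact hT.mono hsub

/-- The estimate after integration over the spheres: `N`, `A`, `Z` are the spherical energies of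
the radial derivative, of the angular operator and of the function, `R` is the pairing of the
equation with the multiplier, and `Y` the energy of the right-hand side. -/
theorem radial_estimate {p δ rH : ℝ} (hp0 : 0 < p) (hp2 : p ≤ 2) (hδ : 0 ≤ δ) (hrH1 : 1 < rH)
    (hrH2 : rH ≤ 2) :
    ∃ C > 0, ∀ {a b : ℝ} {N N' A A' Z Z' D Y R : ℝ → ℝ}, 1 < a → a < b →
      (∀ r, HasDerivAt N (N' r) r) → (∀ r, HasDerivAt A (A' r) r) → (∀ r, HasDerivAt Z (Z' r) r) →
      Continuous N' → Continuous A' → Continuous Z' → Continuous D → ContinuousOn Y (Set.Ioi 1) →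
      (∀ r ∉ Set.Ioo a b, N r = 0 ∧ A r = 0 ∧ Z r = 0 ∧ N' r = 0 ∧ A' r = 0 ∧ Z' r = 0 ∧
        D r = 0 ∧ Y r = 0) →
      (∀ r, 1 < r → 0 ≤ N r ∧ 0 ≤ Z r ∧ 0 ≤ Y r ∧ 0 ≤ D r ∧ Z r ≤ 160 * A r ∧ D r ≤ 5 * A r) →
      (∀ r, 1 < r → R r = (r - 1) ^ 2 * N' r + 4 * (r - 1) / (r + 1) * N r - A' r
        - (2 * r - 1) / (r + 1) ^ 2 * Z' r) →
      (∀ r, 1 < r → ∀ t > 0, -R r ≤ t * N r + (r ^ 2 - 1) * Y r / t) →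
      ∀ ε : ℝ, 0 < ε → ε ≤ 1 →
        ∫ r in Set.Ioi (1 : ℝ), (p * r ^ (p - 1) * (1 - r⁻¹) ^ 2 * N r
            + (2 - p) * r ^ (p - 3) * D r) ≤
          ε * (∫ r in Set.Ioc (1 : ℝ) rH, (1 - r⁻¹) ^ (1 + δ) * N r)
            + C * ε⁻¹ * ∫ r in Set.Ioi (1 : ℝ), r ^ (p - 1) * (1 - r⁻¹) ^ (-δ) * Y r := by
  obtain ⟨C, hC, hpt⟩ := radial_pointwise hp0 hp2 hδ hrH1 hrH2
  refine ⟨C, hC, ?_⟩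
  intro a b N N' A A' Z Z' D Y R ha hab hN hA hZ hN' hA' hZ' hD hY h0 hpos hR hRt ε hε hε1
  have cN : Continuous N := continuous_iff_continuousAt.2 fun r => (hN r).continuousAt
  have cA : Continuous A := continuous_iff_continuousAt.2 fun r => (hA r).continuousAt
  have cZ : Continuous Z := continuous_iff_continuousAt.2 fun r => (hZ r).continuousAt
  have cpow : ∀ e : ℝ, ContinuousOn (fun r : ℝ => r ^ e) (Set.Ioi 1) := fun e =>
    continuousOn_id.rpow_const fun r hr => Or.inl (zero_lt_one.trans hr).ne'
  have cinv : ContinuousOn (fun r : ℝ => 1 - r⁻¹) (Set.Ioi 1) :=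
    continuousOn_const.sub (continuousOn_id.inv₀ fun r hr => (zero_lt_one.trans hr).ne')
  have cyp : ∀ e : ℝ, ContinuousOn (fun r : ℝ => (1 - r⁻¹) ^ e) (Set.Ioi 1) := fun e =>
    cinv.rpow_const fun r hr => Or.inl (sub_pos.2 (inv_lt_one_of_one_lt₀ hr)).ne'
  have cxp : ∀ e : ℝ, ContinuousOn (fun r : ℝ => (r + 1) ^ e) (Set.Ioi 1) := fun e =>
    (by fun_prop : ContinuousOn (fun r : ℝ => r + 1) (Set.Ioi 1)).rpow_const fun r hr =>
      Or.inl (by have := Set.mem_Ioi.1 hr; linarith)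
  have cm : ContinuousOn (multW p) (Set.Ioi 1) :=
    (cxp _).add (continuousOn_const.mul (cxp _))
  have cm' : ContinuousOn (multW' p) (Set.Ioi 1) :=
    (continuousOn_const.mul (cxp _)).add
      (continuousOn_const.mul (continuousOn_const.mul (cxp _)))
  have hx : ∀ r ∈ Set.Ioi (1 : ℝ), r + 1 ≠ 0 := fun r hr => by
    have := Set.mem_Ioi.1 hr; linarith
  set T : ℝ → ℝ := fun r =>
    multW' p r * ((r - 1) ^ 2 * N r - A r - (2 * r - 1) / (r + 1) ^ 2 * Z r)
      + multW p r * ((2 * (r - 1) - 4 * (r - 1) / (r + 1)) * N r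
        - (4 - 2 * r) / (r + 1) ^ 3 * Z r)
      + multW p r * ((r - 1) ^ 2 * N' r + 4 * (r - 1) / (r + 1) * N r - A' r
        - (2 * r - 1) / (r + 1) ^ 2 * Z' r) with hTdef
  have cT : ContinuousOn T (Set.Ioi 1) := by
    have q1 : ContinuousOn (fun r : ℝ => (2 * r - 1) / (r + 1) ^ 2) (Set.Ioi 1) :=
      ContinuousOn.div (by fun_prop) (by fun_prop) fun r hr => pow_ne_zero _ (hx r hr)
    have q2 : ContinuousOn (fun r : ℝ => 4 * (r - 1) / (r + 1)) (Set.Ioi 1) :=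
      ContinuousOn.div (by fun_prop) (by fun_prop) hx
    have q3 : ContinuousOn (fun r : ℝ => (4 - 2 * r) / (r + 1) ^ 3) (Set.Ioi 1) :=
      ContinuousOn.div (by fun_prop) (by fun_prop) fun r hr => pow_ne_zero _ (hx r hr)
    have := cN.continuousOn (s := Set.Ioi 1)
    have := cA.continuousOn (s := Set.Ioi 1)
    have := cZ.continuousOn (s := Set.Ioi 1)
    have := hN'.continuousOn (s := Set.Ioi 1)
    have := hA'.continuousOn (s := Set.Ioi 1)
    have := hZ'.continuousOn (s := Set.Ioi 1)
    fun_prop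
  have hT0 : ∀ r, 1 < r → r ∉ Set.Ioo a b → T r = 0 := by
    intro r _ hr
    obtain ⟨h1, h2, h3, h4, h5, h6, -, -⟩ := h0 r hr
    simp [hTdef, h1, h2, h3, h4, h5, h6]
  have hTint : ∫ r in Set.Ioi (1 : ℝ), T r = 0 := by
    refine setIntegral_Ioi_deriv_eq_zero (P := fun r => multW p r *
      ((r - 1) ^ 2 * N r - A r - (2 * r - 1) / (r + 1) ^ 2 * Z r)) ha hab cT ?_ hT0 ?_ ?_
    · intro r hr
      have hxr := hx r hr
      have d1 : HasDerivAt (fun r : ℝ => (r - 1) ^ 2) (2 * (r - 1)) r := by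
        simpa using ((hasDerivAt_id r).sub_const 1).fun_pow 2
      have d2 : HasDerivAt (fun r : ℝ => (2 * r - 1) / (r + 1) ^ 2) ((4 - 2 * r) / (r + 1) ^ 3) r := by
        have e1 : HasDerivAt (fun r : ℝ => 2 * r - 1) 2 r := by
          simpa using ((hasDerivAt_id r).const_mul 2).sub_const 1
        have e2 : HasDerivAt (fun r : ℝ => (r + 1) ^ 2) (2 * (r + 1)) r := by
          simpa using ((hasDerivAt_id r).add_const 1).fun_pow 2
        refine (e1.fun_div e2 (pow_ne_zero 2 hxr)).congr_deriv ?_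
        field_simp; ring
      have := (hasDerivAt_multW p hr).fun_mul
        (((d1.fun_mul (hN r)).fun_sub (hA r)).fun_sub (d2.fun_mul (hZ r)))
      refine this.congr_deriv ?_
      simp only [hTdef]
      ring
    · obtain ⟨h1, h2, h3, -⟩ := h0 a (by simp)
      simp [h1, h2, h3]
    · obtain ⟨h1, h2, h3, -⟩ := h0 b (by simp)
      simp [h1, h2, h3]
  have iT : IntegrableOn T (Set.Ioi 1) := integrableOn_Ioi_of_eq_zero (b := b) ha cT hT0
  have iL : IntegrableOn (fun r => p * r ^ (p - 1) * (1 - r⁻¹) ^ 2 * N r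
      + (2 - p) * r ^ (p - 3) * D r) (Set.Ioi 1) := by
    refine integrableOn_Ioi_of_eq_zero (b := b) ha ?_ fun r _ hr => ?_
    · exact (((continuousOn_const.mul (cpow _)).mul (cinv.pow 2)).mul cN.continuousOn).add
        ((continuousOn_const.mul (cpow _)).mul hD.continuousOn)
    · obtain ⟨h1, -, -, -, -, -, h7, -⟩ := h0 r hr
      simp [h1, h7]
  have iN : IntegrableOn (fun r => (1 - r⁻¹) ^ (1 + δ) * N r) (Set.Ioi 1) := by
    refine integrableOn_Ioi_of_eq_zero (b := b) ha ((cyp _).mul cN.continuousOn) fun r _ hr => ?_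
    simp [(h0 r hr).1]
  have iY : IntegrableOn (fun r => r ^ (p - 1) * (1 - r⁻¹) ^ (-δ) * Y r) (Set.Ioi 1) := by
    refine integrableOn_Ioi_of_eq_zero (b := b) ha (((cpow _).mul (cyp _)).mul hY) fun r _ hr => ?_
    obtain ⟨-, -, -, -, -, -, -, h8⟩ := h0 r hr
    simp [h8]
  have hind : (fun r => if r ≤ rH then (1 - r⁻¹) ^ (1 + δ) * N r else 0)
      = (Set.Iic rH).indicator fun r => (1 - r⁻¹) ^ (1 + δ) * N r := by
    ext r; simp [Set.indicator_apply]
  have iI : IntegrableOn (fun r => if r ≤ rH then (1 - r⁻¹) ^ (1 + δ) * N r else 0)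
      (Set.Ioi 1) := by
    rw [hind]; exact iN.indicator measurableSet_Iic
  have hIint : ∫ r in Set.Ioi (1 : ℝ), (if r ≤ rH then (1 - r⁻¹) ^ (1 + δ) * N r else 0)
      = ∫ r in Set.Ioc (1 : ℝ) rH, (1 - r⁻¹) ^ (1 + δ) * N r := by
    rw [hind, setIntegral_indicator measurableSet_Iic, Set.Ioi_inter_Iic]
  have iTI : IntegrableOn (fun r => 80 * T r
      + ε * (if r ≤ rH then (1 - r⁻¹) ^ (1 + δ) * N r else 0)) (Set.Ioi 1) :=
    (iT.const_mul 80).add (iI.const_mul ε)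
  calc _ ≤ ∫ r in Set.Ioi (1 : ℝ), (80 * T r
        + ε * (if r ≤ rH then (1 - r⁻¹) ^ (1 + δ) * N r else 0)
        + C * ε⁻¹ * (r ^ (p - 1) * (1 - r⁻¹) ^ (-δ) * Y r)) := by
        refine setIntegral_mono_on iL (iTI.add (iY.const_mul (C * ε⁻¹))) measurableSet_Ioi fun r hr => ?_
        obtain ⟨p1, p2, p3, p4, p5, p6⟩ := hpos r hr
        exact hpt hr hε hε1 p1 p2 p3 p4 p5 p6 (hRt r hr) (by rw [hR r hr])
    _ = _ := by
        rw [integral_add iTI (iY.const_mul (C * ε⁻¹)),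
          integral_add (iT.const_mul 80) (iI.const_mul ε), integral_const_mul,
          integral_const_mul, integral_const_mul, hTint, hIint]
        ring

/-- Integral over the coordinate rectangle `(0,π) × (0,2π)`. -/
def sphInt (G : ℝ → ℝ → ℝ) : ℝ :=
  ∫ θ in (0 : ℝ)..Real.pi, ∫ φ in (0 : ℝ)..(2 * Real.pi), G θ φ

lemma continuous_inner_sphInt {G : ℝ → ℝ → ℝ} (hG : Continuous (Function.uncurry G)) (a b : ℝ) :
    Continuous fun θ => ∫ φ in a..b, G θ φ :=
  intervalIntegral.continuous_parametric_intervalIntegral_of_continuous' hG a b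

lemma sphInt_add {G H : ℝ → ℝ → ℝ} (hG : Continuous (Function.uncurry G))
    (hH : Continuous (Function.uncurry H)) :
    sphInt (fun θ φ => G θ φ + H θ φ) = sphInt G + sphInt H := by
  unfold sphInt
  rw [← intervalIntegral.integral_add
    ((continuous_inner_sphInt hG _ _).intervalIntegrable _ _)
    ((continuous_inner_sphInt hH _ _).intervalIntegrable _ _)]
  refine intervalIntegral.integral_congr fun θ _ => ?_
  exact intervalIntegral.integral_add ((hG.uncurry_left θ).intervalIntegrable _ _)
    ((hH.uncurry_left θ).intervalIntegrable _ _)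

lemma sphInt_const_mul (c : ℝ) (G : ℝ → ℝ → ℝ) :
    sphInt (fun θ φ => c * G θ φ) = c * sphInt G := by
  simp [sphInt]

lemma sphInt_mono {G H : ℝ → ℝ → ℝ} (hG : Continuous (Function.uncurry G))
    (hH : Continuous (Function.uncurry H))
    (h : ∀ θ ∈ Set.Icc 0 Real.pi, ∀ φ, G θ φ ≤ H θ φ) : sphInt G ≤ sphInt H := by
  unfold sphInt
  refine intervalIntegral.integral_mono_on Real.pi_pos.le
    ((continuous_inner_sphInt hG _ _).intervalIntegrable _ _)
    ((continuous_inner_sphInt hH _ _).intervalIntegrable _ _) fun θ hθ => ?_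
  exact intervalIntegral.integral_mono_on Real.two_pi_pos.le
    ((hG.uncurry_left θ).intervalIntegrable _ _)
    ((hH.uncurry_left θ).intervalIntegrable _ _) fun φ _ => h θ hθ φ

lemma sphInt_mono_inner {G H : ℝ → ℝ → ℝ} (hG : Continuous (Function.uncurry G))
    (hH : Continuous (Function.uncurry H))
    (h : ∀ θ ∈ Set.Icc 0 Real.pi, ∫ φ in (0 : ℝ)..(2 * Real.pi), G θ φ ≤
      ∫ φ in (0 : ℝ)..(2 * Real.pi), H θ φ) : sphInt G ≤ sphInt H :=
  intervalIntegral.integral_mono_on Real.pi_pos.le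
    ((continuous_inner_sphInt hG _ _).intervalIntegrable _ _)
    ((continuous_inner_sphInt hH _ _).intervalIntegrable _ _) h

lemma sphInt_nonneg {G : ℝ → ℝ → ℝ}
    (h : ∀ θ ∈ Set.Icc 0 Real.pi, ∀ φ, 0 ≤ G θ φ) : 0 ≤ sphInt G :=
  intervalIntegral.integral_nonneg Real.pi_pos.le fun θ hθ =>
    intervalIntegral.integral_nonneg Real.two_pi_pos.le fun φ _ => h θ hθ φ

lemma sphInt_deriv_phi {Q Q' : ℝ → ℝ → ℝ} (hQ' : Continuous (Function.uncurry Q'))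
    (hd : ∀ θ φ, HasDerivAt (Q θ) (Q' θ φ) φ) (hper : ∀ θ, Q θ (2 * Real.pi) = Q θ 0) :
    sphInt Q' = 0 := by
  unfold sphInt
  have : ∀ θ, ∫ φ in (0 : ℝ)..(2 * Real.pi), Q' θ φ = 0 := fun θ => by
    rw [intervalIntegral.integral_eq_sub_of_hasDerivAt (fun φ _ => hd θ φ)
      ((hQ'.uncurry_left θ).intervalIntegrable _ _), hper, sub_self]
  simp [this]

lemma sphInt_deriv_theta {Q Q' : ℝ → ℝ → ℝ} (hQ' : Continuous (Function.uncurry Q'))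
    (hd : ∀ θ φ, HasDerivAt (fun t => Q t φ) (Q' θ φ) θ) (h : ∀ φ, Q Real.pi φ = Q 0 φ) :
    sphInt Q' = 0 := by
  unfold sphInt
  rw [intervalIntegral_intervalIntegral_swap]
  · have : ∀ φ, ∫ θ in (0 : ℝ)..Real.pi, Q' θ φ = 0 := fun φ => by
      rw [intervalIntegral.integral_eq_sub_of_hasDerivAt (fun θ _ => hd θ φ)
        ((hQ'.uncurry_right φ).intervalIntegrable _ _), h, sub_self]
    simp [this]
  · refine IntegrableOn.mono_set ?_ (Set.prod_mono Set.uIoc_subset_uIcc Set.uIoc_subset_uIcc)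
    exact hQ'.continuousOn.integrableOn_compact (isCompact_uIcc.prod isCompact_uIcc)

lemma hasDerivAt_intervalIntegral_param {F F' : ℝ → ℝ → ℝ} (hF : Continuous (Function.uncurry F))
    (hF' : Continuous (Function.uncurry F')) (hd : ∀ r t, HasDerivAt (fun s => F s t) (F' r t) r)
    (a b r : ℝ) :
    HasDerivAt (fun s => ∫ t in a..b, F s t) (∫ t in a..b, F' r t) r := by
  obtain ⟨M, hM⟩ := ((isCompact_Icc (a := r - 1) (b := r + 1)).prod
    (isCompact_uIcc (a := a) (b := b))).exists_bound_of_continuousOn hF'.continuousOn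
  refine (intervalIntegral.hasDerivAt_integral_of_dominated_loc_of_deriv_le
    (s := Set.Icc (r - 1) (r + 1)) (bound := fun _ => M)
    (Icc_mem_nhds (by linarith) (by linarith)) (Filter.Eventually.of_forall fun s =>
      (hF.uncurry_left s).aestronglyMeasurable) ((hF.uncurry_left r).intervalIntegrable _ _)
    (hF'.uncurry_left r).aestronglyMeasurable ?_ intervalIntegrable_const
    (Filter.Eventually.of_forall fun t _ s _ => hd s t)).2
  exact Filter.Eventually.of_forall fun t ht s hs => hM (s, t) ⟨hs, Set.uIoc_subset_uIcc ht⟩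

lemma continuous_sphInt {F : ℝ → ℝ → ℝ → ℝ}
    (hF : Continuous fun x : ℝ × ℝ × ℝ => F x.1 x.2.1 x.2.2) :
    Continuous fun r => sphInt (F r) := by
  refine continuous_inner_sphInt (G := fun r θ => ∫ φ in (0 : ℝ)..(2 * Real.pi), F r θ φ) ?_ _ _
  refine intervalIntegral.continuous_parametric_intervalIntegral_of_continuous'
    (f := fun (x : ℝ × ℝ) φ => F x.1 x.2 φ) ?_ _ _
  exact hF.comp (by fun_prop : Continuous fun x : (ℝ × ℝ) × ℝ => (x.1.1, x.1.2, x.2))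

lemma hasDerivAt_sphInt {F F' : ℝ → ℝ → ℝ → ℝ}
    (hF : Continuous fun x : ℝ × ℝ × ℝ => F x.1 x.2.1 x.2.2)
    (hF' : Continuous fun x : ℝ × ℝ × ℝ => F' x.1 x.2.1 x.2.2)
    (hd : ∀ r θ φ, HasDerivAt (fun s => F s θ φ) (F' r θ φ) r) (r : ℝ) :
    HasDerivAt (fun s => sphInt (F s)) (sphInt (F' r)) r := by
  have inner : ∀ {H : ℝ → ℝ → ℝ → ℝ}, (Continuous fun x : ℝ × ℝ × ℝ => H x.1 x.2.1 x.2.2) →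
      Continuous (Function.uncurry fun r θ => ∫ φ in (0 : ℝ)..(2 * Real.pi), H r θ φ) := by
    intro H hH
    refine intervalIntegral.continuous_parametric_intervalIntegral_of_continuous'
      (f := fun (x : ℝ × ℝ) φ => H x.1 x.2 φ) ?_ _ _
    exact hH.comp (by fun_prop : Continuous fun x : (ℝ × ℝ) × ℝ => (x.1.1, x.1.2, x.2))
  refine hasDerivAt_intervalIntegral_param (inner hF) (inner hF') (fun r θ => ?_) _ _ r
  refine hasDerivAt_intervalIntegral_param (F := fun r φ => F r θ φ) (F' := fun r φ => F' r θ φ)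
    ?_ ?_ (fun r φ => hd r θ φ) _ _ r
  · exact hF.comp (by fun_prop : Continuous fun x : ℝ × ℝ => (x.1, θ, x.2))
  · exact hF'.comp (by fun_prop : Continuous fun x : ℝ × ℝ => (x.1, θ, x.2))

lemma setIntegral_eq_sphInt {G H : ℝ → ℝ → ℝ}
    (h : ∀ θ ∈ Set.Ioo 0 Real.pi, ∀ φ, G θ φ = H θ φ) :
    ∫ θ in Set.Ioo (0 : ℝ) Real.pi, ∫ φ in Set.Ioo (0 : ℝ) (2 * Real.pi), G θ φ = sphInt H := by
  unfold sphInt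
  rw [intervalIntegral.integral_of_le Real.pi_pos.le, ← integral_Ioc_eq_integral_Ioo,
    integral_Ioc_eq_integral_Ioo, integral_Ioc_eq_integral_Ioo]
  refine setIntegral_congr_fun measurableSet_Ioo fun θ hθ => ?_
  rw [intervalIntegral.integral_of_le Real.two_pi_pos.le, integral_Ioc_eq_integral_Ioo]
  exact setIntegral_congr_fun measurableSet_Ioo fun φ _ => h θ hθ φ

section
variable {F : Type*} [NormedAddCommGroup F] [NormedSpace ℝ F] [CompleteSpace F]

/-- A Poincaré inequality for functions of mean zero on `[0,2π]`. -/
lemma integral_norm_sq_le_of_mean_zero {f f' : ℝ → F} (hf' : Continuous f')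
    (hd : ∀ x, HasDerivAt f (f' x) x) (hmean : ∫ x in (0 : ℝ)..(2 * Real.pi), f x = 0) :
    ∫ x in (0 : ℝ)..(2 * Real.pi), ‖f x‖ ^ 2 ≤
      40 * ∫ x in (0 : ℝ)..(2 * Real.pi), ‖f' x‖ ^ 2 := by
  have hT : (0 : ℝ) < 2 * Real.pi := Real.two_pi_pos
  have hf : Continuous f := continuous_iff_continuousAt.2 fun x => (hd x).continuousAt
  set T := 2 * Real.pi with hTdef
  set M := ∫ x in (0 : ℝ)..T, ‖f' x‖ with hM
  set Q := ∫ x in (0 : ℝ)..T, ‖f' x‖ ^ 2 with hQ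
  have hM0 : 0 ≤ M := intervalIntegral.integral_nonneg hT.le fun x _ => norm_nonneg _
  have hdiff : ∀ x ∈ Set.Icc 0 T, ∀ y ∈ Set.Icc 0 T, ‖f x - f y‖ ≤ M := by
    intro x hx y hy
    rw [← intervalIntegral.integral_eq_sub_of_hasDerivAt (fun z _ => hd z)
      (hf'.intervalIntegrable _ _)]
    refine (intervalIntegral.norm_integral_le_abs_integral_norm).trans ?_
    rw [← abs_of_nonneg hM0, hM]
    refine intervalIntegral.abs_integral_mono_interval ?_ (Filter.Eventually.of_forall fun z => norm_nonneg _)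
      (hf'.norm.intervalIntegrable _ _)
    rw [Set.uIoc_of_le hT.le]
    exact Set.Ioc_subset_Ioc (le_min hy.1 hx.1) (max_le hy.2 hx.2)
  have hsup : ∀ x ∈ Set.Icc 0 T, ‖f x‖ ≤ M := by
    intro x hx
    have h1 : ∫ y in (0 : ℝ)..T, (f x - f y) = T • f x := by
      rw [intervalIntegral.integral_sub intervalIntegrable_const (hf.intervalIntegrable _ _), hmean]
      simp
    have h2 := intervalIntegral.norm_integral_le_of_norm_le_const (a := (0 : ℝ)) (b := T) (C := M)
      (f := fun y => f x - f y) (fun y hy => hdiff x hx y (by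
        rw [Set.uIoc_of_le hT.le] at hy; exact ⟨hy.1.le, hy.2⟩))
    rw [h1, norm_smul, sub_zero, abs_of_pos hT, Real.norm_of_nonneg hT.le, mul_comm] at h2
    exact le_of_mul_le_mul_right h2 hT
  have hCS : M ^ 2 ≤ T * Q := by
    have h0 : 0 ≤ ∫ x in (0 : ℝ)..T, (‖f' x‖ - M / T) ^ 2 :=
      intervalIntegral.integral_nonneg hT.le fun x _ => sq_nonneg _
    have e : ∫ x in (0 : ℝ)..T, (‖f' x‖ - M / T) ^ 2 = Q - M ^ 2 / T := by
      have : ∀ x, (‖f' x‖ - M / T) ^ 2 = ‖f' x‖ ^ 2 - (2 * (M / T)) * ‖f' x‖ + (M / T) ^ 2 :=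
        fun x => by ring
      simp_rw [this]
      rw [intervalIntegral.integral_add, intervalIntegral.integral_sub,
        intervalIntegral.integral_const_mul, intervalIntegral.integral_const]
      · rw [← hM, ← hQ, smul_eq_mul]; field_simp; ring
      all_goals exact Continuous.intervalIntegrable (by fun_prop) _ _
    rw [e, sub_nonneg, div_le_iff₀ hT] at h0
    linarith
  have hfin : ∫ x in (0 : ℝ)..T, ‖f x‖ ^ 2 ≤ ∫ x in (0 : ℝ)..T, M ^ 2 :=
    intervalIntegral.integral_mono_on hT.le ((hf.norm.pow 2).intervalIntegrable _ _)
      intervalIntegrable_const fun x hx => pow_le_pow_left₀ (norm_nonneg _) (hsup x hx) 2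
  rw [intervalIntegral.integral_const, smul_eq_mul, sub_zero] at hfin
  have hQ0 : 0 ≤ Q := intervalIntegral.integral_nonneg hT.le fun x _ => sq_nonneg _
  have hTT : T * T ≤ 40 := by
    rw [hTdef]; nlinarith [Real.pi_lt_d2, Real.pi_pos]
  calc _ ≤ T * M ^ 2 := hfin
    _ ≤ T * (T * Q) := mul_le_mul_of_nonneg_left hCS hT.le
    _ = T * T * Q := by ring
    _ ≤ 40 * Q := mul_le_mul_of_nonneg_right hTT hQ0

end

/-- A field on `ℝ × S²` in spherical coordinates together with the derivatives used below. All
the entries are continuous up to the poles; `W` is `(sin θ)⁻¹ ∂_φ z` and `S` is the spherical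
Laplacian of `z`. -/
structure SphericalJet {F : Type*} [NormedAddCommGroup F] [NormedSpace ℝ F]
    (z : ℝ → ℝ → ℝ → F) where
  zr : ℝ → ℝ → ℝ → F
  zt : ℝ → ℝ → ℝ → F
  W : ℝ → ℝ → ℝ → F
  zrr : ℝ → ℝ → ℝ → F
  zrt : ℝ → ℝ → ℝ → F
  Wr : ℝ → ℝ → ℝ → F
  ztt : ℝ → ℝ → ℝ → F
  Wp : ℝ → ℝ → ℝ → F
  S : ℝ → ℝ → ℝ → F
  continuous_z : Continuous fun x : ℝ × ℝ × ℝ => z x.1 x.2.1 x.2.2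
  continuous_zr : Continuous fun x : ℝ × ℝ × ℝ => zr x.1 x.2.1 x.2.2
  continuous_zt : Continuous fun x : ℝ × ℝ × ℝ => zt x.1 x.2.1 x.2.2
  continuous_W : Continuous fun x : ℝ × ℝ × ℝ => W x.1 x.2.1 x.2.2
  continuous_zrr : Continuous fun x : ℝ × ℝ × ℝ => zrr x.1 x.2.1 x.2.2
  continuous_zrt : Continuous fun x : ℝ × ℝ × ℝ => zrt x.1 x.2.1 x.2.2
  continuous_Wr : Continuous fun x : ℝ × ℝ × ℝ => Wr x.1 x.2.1 x.2.2
  continuous_ztt : Continuous fun x : ℝ × ℝ × ℝ => ztt x.1 x.2.1 x.2.2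
  continuous_Wp : Continuous fun x : ℝ × ℝ × ℝ => Wp x.1 x.2.1 x.2.2
  continuous_S : Continuous fun x : ℝ × ℝ × ℝ => S x.1 x.2.1 x.2.2
  z_r : ∀ r θ φ, HasDerivAt (fun s => z s θ φ) (zr r θ φ) r
  z_t : ∀ r θ φ, HasDerivAt (fun t => z r t φ) (zt r θ φ) θ
  z_p : ∀ r θ φ, HasDerivAt (fun q => z r θ q) (Real.sin θ • W r θ φ) φ
  zr_r : ∀ r θ φ, HasDerivAt (fun s => zr s θ φ) (zrr r θ φ) r
  zr_t : ∀ r θ φ, HasDerivAt (fun t => zr r t φ) (zrt r θ φ) θ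
  zr_p : ∀ r θ φ, HasDerivAt (fun q => zr r θ q) (Real.sin θ • Wr r θ φ) φ
  zt_r : ∀ r θ φ, HasDerivAt (fun s => zt s θ φ) (zrt r θ φ) r
  zt_t : ∀ r θ φ, HasDerivAt (fun t => zt r t φ) (ztt r θ φ) θ
  W_r : ∀ r θ φ, HasDerivAt (fun s => W s θ φ) (Wr r θ φ) r
  W_p : ∀ r θ φ, HasDerivAt (fun q => W r θ q) (Wp r θ φ) φ
  sin_smul_S : ∀ r θ φ, Real.sin θ • S r θ φ =
    Real.cos θ • zt r θ φ + Real.sin θ • ztt r θ φ + Wp r θ φ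
  zr_periodic : ∀ r θ, zr r θ (2 * Real.pi) = zr r θ 0
  W_periodic : ∀ r θ, W r θ (2 * Real.pi) = W r θ 0

namespace SphericalJet

variable {F : Type*} [NormedAddCommGroup F] [InnerProductSpace ℝ F] {z : ℝ → ℝ → ℝ → F}

/-- The operator `√(r²-1) ℒ (r²-1)^{-1/2}` applied to `z`; the modulus in the coefficients only
serves to make it continuous on all of `ℝ³`. -/
def conj (J : SphericalJet z) (r θ φ : ℝ) : F :=
  (r - 1) ^ 2 • J.zrr r θ φ + (2 * (r - 1) / (|r| + 1)) • J.zr r θ φ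
    - ((r ^ 2 - 1) * Real.sin θ) • J.Wr r θ φ + J.S r θ φ
    + ((1 / 4 * Real.sin θ ^ 2 - 1) * Real.sin θ) • J.Wp r θ φ
    - ((2 * r - 1) / (|r| + 1) ^ 2) • z r θ φ

/-- `N = ∫ |∂_r z|²` over the sphere. -/
def eN (J : SphericalJet z) (r : ℝ) : ℝ := sphInt fun θ φ => ‖J.zr r θ φ‖ ^ 2 * Real.sin θ
def eN' (J : SphericalJet z) (r : ℝ) : ℝ :=
  sphInt fun θ φ => 2 * inner ℝ (J.zr r θ φ) (J.zrr r θ φ) * Real.sin θ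
/-- The spherical energy `∫ |∂_θ z|² + (1 - ½ sin² θ)² |W|²`. -/
def eA (J : SphericalJet z) (r : ℝ) : ℝ :=
  sphInt fun θ φ => (‖J.zt r θ φ‖ ^ 2 + (1 - Real.sin θ ^ 2 / 2) ^ 2 * ‖J.W r θ φ‖ ^ 2) * Real.sin θ
def eA' (J : SphericalJet z) (r : ℝ) : ℝ :=
  sphInt fun θ φ => (2 * inner ℝ (J.zt r θ φ) (J.zrt r θ φ)
    + (1 - Real.sin θ ^ 2 / 2) ^ 2 * (2 * inner ℝ (J.W r θ φ) (J.Wr r θ φ))) * Real.sin θ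
def eZ (_ : SphericalJet z) (r : ℝ) : ℝ := sphInt fun θ φ => ‖z r θ φ‖ ^ 2 * Real.sin θ
def eZ' (J : SphericalJet z) (r : ℝ) : ℝ :=
  sphInt fun θ φ => 2 * inner ℝ (z r θ φ) (J.zr r θ φ) * Real.sin θ
def eD (J : SphericalJet z) (r : ℝ) : ℝ :=
  sphInt fun θ φ => (‖J.zt r θ φ‖ ^ 2 + (1 + 1 / 4 * Real.sin θ ^ 4) * ‖J.W r θ φ‖ ^ 2) * Real.sin θ
def eL (J : SphericalJet z) (r : ℝ) : ℝ := sphInt fun θ φ => ‖J.conj r θ φ‖ ^ 2 * Real.sin θ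
def eR (J : SphericalJet z) (r : ℝ) : ℝ :=
  sphInt fun θ φ => 2 * inner ℝ (J.conj r θ φ) (J.zr r θ φ) * Real.sin θ

lemma continuous_conj (J : SphericalJet z) :
    Continuous fun x : ℝ × ℝ × ℝ => J.conj x.1 x.2.1 x.2.2 := by
  have h : ∀ x : ℝ × ℝ × ℝ, |x.1| + 1 ≠ 0 := fun x => by positivity
  have h1 := J.continuous_z
  have h2 := J.continuous_zr
  have h3 := J.continuous_zrr
  have h4 := J.continuous_Wr
  have h5 := J.continuous_Wp
  have h6 := J.continuous_S
  have h7 : Continuous fun x : ℝ × ℝ × ℝ => 2 * (x.1 - 1) / (|x.1| + 1) :=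
    Continuous.div (by fun_prop) (by fun_prop) h
  have h8 : Continuous fun x : ℝ × ℝ × ℝ => (2 * x.1 - 1) / (|x.1| + 1) ^ 2 :=
    Continuous.div (by fun_prop) (by fun_prop) fun x => pow_ne_zero _ (h x)
  unfold conj
  fun_prop

lemma hasDerivAt_eN (J : SphericalJet z) (r : ℝ) : HasDerivAt J.eN (J.eN' r) r := by
  have h2 := J.continuous_zr
  have h3 := J.continuous_zrr
  exact hasDerivAt_sphInt (F := fun r θ φ => ‖J.zr r θ φ‖ ^ 2 * Real.sin θ)
    (F' := fun r θ φ => 2 * inner ℝ (J.zr r θ φ) (J.zrr r θ φ) * Real.sin θ)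
    (by fun_prop) (by fun_prop) (fun r θ φ => (J.zr_r r θ φ).norm_sq.mul_const _) r

lemma hasDerivAt_eZ (J : SphericalJet z) (r : ℝ) : HasDerivAt J.eZ (J.eZ' r) r := by
  have h2 := J.continuous_zr
  have h3 := J.continuous_z
  exact hasDerivAt_sphInt (F := fun r θ φ => ‖z r θ φ‖ ^ 2 * Real.sin θ)
    (F' := fun r θ φ => 2 * inner ℝ (z r θ φ) (J.zr r θ φ) * Real.sin θ)
    (by fun_prop) (by fun_prop) (fun r θ φ => (J.z_r r θ φ).norm_sq.mul_const _) r

lemma hasDerivAt_eA (J : SphericalJet z) (r : ℝ) : HasDerivAt J.eA (J.eA' r) r := by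
  have h1 := J.continuous_zt
  have h2 := J.continuous_W
  have h3 := J.continuous_zrt
  have h4 := J.continuous_Wr
  exact hasDerivAt_sphInt
    (F := fun r θ φ =>
      (‖J.zt r θ φ‖ ^ 2 + (1 - Real.sin θ ^ 2 / 2) ^ 2 * ‖J.W r θ φ‖ ^ 2) * Real.sin θ)
    (F' := fun r θ φ => (2 * inner ℝ (J.zt r θ φ) (J.zrt r θ φ)
      + (1 - Real.sin θ ^ 2 / 2) ^ 2 * (2 * inner ℝ (J.W r θ φ) (J.Wr r θ φ))) * Real.sin θ)
    (by fun_prop) (by fun_prop)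
    (fun r θ φ => ((J.zt_r r θ φ).norm_sq.add ((J.W_r r θ φ).norm_sq.const_mul _)).mul_const _) r

lemma continuous_eN' (J : SphericalJet z) : Continuous J.eN' := by
  have h2 := J.continuous_zr
  have h3 := J.continuous_zrr
  exact continuous_sphInt (by fun_prop)

lemma continuous_eZ' (J : SphericalJet z) : Continuous J.eZ' := by
  have h2 := J.continuous_zr
  have h3 := J.continuous_z
  exact continuous_sphInt (by fun_prop)

lemma continuous_eA' (J : SphericalJet z) : Continuous J.eA' := by
  have h1 := J.continuous_zt
  have h2 := J.continuous_W
  have h3 := J.continuous_zrt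
  have h4 := J.continuous_Wr
  exact continuous_sphInt (by fun_prop)

lemma continuous_eD (J : SphericalJet z) : Continuous J.eD := by
  have h1 := J.continuous_zt
  have h2 := J.continuous_W
  exact continuous_sphInt (by fun_prop)

lemma continuous_eL (J : SphericalJet z) : Continuous J.eL := by
  have h1 := J.continuous_conj
  exact continuous_sphInt (by fun_prop)

lemma eN_nonneg (J : SphericalJet z) (r : ℝ) : 0 ≤ J.eN r :=
  sphInt_nonneg fun _ hθ _ => mul_nonneg (by positivity) (Real.sin_nonneg_of_mem_Icc hθ)

lemma eZ_nonneg (J : SphericalJet z) (r : ℝ) : 0 ≤ J.eZ r :=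
  sphInt_nonneg fun _ hθ _ => mul_nonneg (by positivity) (Real.sin_nonneg_of_mem_Icc hθ)

lemma eL_nonneg (J : SphericalJet z) (r : ℝ) : 0 ≤ J.eL r :=
  sphInt_nonneg fun _ hθ _ => mul_nonneg (by positivity) (Real.sin_nonneg_of_mem_Icc hθ)

lemma eD_nonneg (J : SphericalJet z) (r : ℝ) : 0 ≤ J.eD r :=
  sphInt_nonneg fun _ hθ _ => mul_nonneg (by positivity) (Real.sin_nonneg_of_mem_Icc hθ)

lemma eD_le (J : SphericalJet z) (r : ℝ) : J.eD r ≤ 5 * J.eA r := by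
  have h1 := J.continuous_zt
  have h2 := J.continuous_W
  rw [eA, ← sphInt_const_mul]
  refine sphInt_mono (by fun_prop) (by fun_prop) fun θ hθ φ => ?_
  rw [← mul_assoc]
  refine mul_le_mul_of_nonneg_right ?_ (Real.sin_nonneg_of_mem_Icc hθ)
  have hs := Real.sin_sq_le_one θ
  have hs0 := sq_nonneg (Real.sin θ)
  have : 1 + 1 / 4 * Real.sin θ ^ 4 ≤ 5 * (1 - Real.sin θ ^ 2 / 2) ^ 2 := by
    nlinarith
  nlinarith [sq_nonneg ‖J.zt r θ φ‖, mul_le_mul_of_nonneg_right this (sq_nonneg ‖J.W r θ φ‖)]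

lemma eZ_le [CompleteSpace F] (J : SphericalJet z) {r : ℝ}
    (hmean : ∀ θ, ∫ φ in (0 : ℝ)..(2 * Real.pi), z r θ φ = 0) : J.eZ r ≤ 160 * J.eA r := by
  have h0 := J.continuous_z
  have h1 := J.continuous_zt
  have h2 := J.continuous_W
  rw [eA, ← sphInt_const_mul]
  refine sphInt_mono_inner (by fun_prop) (by fun_prop) fun θ hθ => ?_
  have hP := integral_norm_sq_le_of_mean_zero (f := z r θ) (f' := fun φ => Real.sin θ • J.W r θ φ)
    (by fun_prop) (J.z_p r θ) (hmean θ)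
  have hsin := Real.sin_nonneg_of_mem_Icc hθ
  rw [intervalIntegral.integral_mul_const]
  refine (mul_le_mul_of_nonneg_right hP hsin).trans ?_
  rw [← intervalIntegral.integral_const_mul, ← intervalIntegral.integral_mul_const]
  refine intervalIntegral.integral_mono_on Real.two_pi_pos.le
    (Continuous.intervalIntegrable (by fun_prop) _ _)
    (Continuous.intervalIntegrable (by fun_prop) _ _) fun φ _ => ?_
  rw [← mul_assoc]
  refine mul_le_mul_of_nonneg_right ?_ hsin
  have hs := Real.sin_sq_le_one θ
  have hs0 := sq_nonneg (Real.sin θ)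
  have : 40 * Real.sin θ ^ 2 ≤ 160 * (1 - Real.sin θ ^ 2 / 2) ^ 2 := by
    nlinarith
  rw [norm_smul, mul_pow, Real.norm_eq_abs, sq_abs]
  nlinarith [sq_nonneg ‖J.zt r θ φ‖, mul_le_mul_of_nonneg_right this (sq_nonneg ‖J.W r θ φ‖)]

lemma neg_eR_le (J : SphericalJet z) (r : ℝ) {t : ℝ} (ht : 0 < t) :
    -J.eR r ≤ t * J.eN r + J.eL r / t := by
  have h1 := J.continuous_conj
  have h2 := J.continuous_zr
  have hn : -J.eR r = -1 * J.eR r := by ring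
  have hl : J.eL r / t = t⁻¹ * J.eL r := by ring
  rw [hn, hl, eR, eN, eL, ← sphInt_const_mul, ← sphInt_const_mul, ← sphInt_const_mul,
    ← sphInt_add (by fun_prop) (by fun_prop)]
  refine sphInt_mono (by fun_prop) (by fun_prop) fun θ hθ φ => ?_
  set x := J.conj r θ φ
  set y := J.zr r θ φ
  have key : -(2 * inner ℝ x y) ≤ t * ‖y‖ ^ 2 + t⁻¹ * ‖x‖ ^ 2 := by
    have hc := neg_le_of_abs_le (abs_real_inner_le_norm x y)
    have e : t * ‖y‖ ^ 2 + t⁻¹ * ‖x‖ ^ 2 - 2 * (‖x‖ * ‖y‖) = t⁻¹ * (t * ‖y‖ - ‖x‖) ^ 2 := by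
      field_simp; ring
    have : 0 ≤ t⁻¹ * (t * ‖y‖ - ‖x‖) ^ 2 := by positivity
    linarith
  calc _ = -(2 * inner ℝ x y) * Real.sin θ := by ring
    _ ≤ (t * ‖y‖ ^ 2 + t⁻¹ * ‖x‖ ^ 2) * Real.sin θ :=
      mul_le_mul_of_nonneg_right key (Real.sin_nonneg_of_mem_Icc hθ)
    _ = _ := by ring

/-- The radial multiplier `∂_r z` against the conjugated operator, integrated over the sphere. -/
lemma eR_eq (J : SphericalJet z) {r : ℝ} (hr : 0 ≤ r) :
    J.eR r = (r - 1) ^ 2 * J.eN' r + 4 * (r - 1) / (r + 1) * J.eN r - J.eA' r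
      - (2 * r - 1) / (r + 1) ^ 2 * J.eZ' r := by
  have c0 := J.continuous_z
  have c1 := J.continuous_zr
  have c2 := J.continuous_zt
  have c3 := J.continuous_W
  have c4 := J.continuous_zrr
  have c5 := J.continuous_zrt
  have c6 := J.continuous_Wr
  have c7 := J.continuous_ztt
  have c8 := J.continuous_Wp
  have i1 : sphInt (fun θ φ => Real.sin θ * (2 * inner ℝ (J.zr r θ φ) (Real.sin θ • J.Wr r θ φ)))
      = 0 :=
    sphInt_deriv_phi (Q := fun θ φ => Real.sin θ * ‖J.zr r θ φ‖ ^ 2) (by fun_prop)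
      (fun θ φ => (J.zr_p r θ φ).norm_sq.const_mul _) fun θ => by simp only [J.zr_periodic]
  have i2 : sphInt (fun θ φ => Real.cos θ * inner ℝ (J.zt r θ φ) (J.zr r θ φ) + Real.sin θ *
      (inner ℝ (J.zt r θ φ) (J.zrt r θ φ) + inner ℝ (J.ztt r θ φ) (J.zr r θ φ))) = 0 :=
    sphInt_deriv_theta (Q := fun θ φ => Real.sin θ * inner ℝ (J.zt r θ φ) (J.zr r θ φ))
      (by fun_prop) (fun θ φ => (Real.hasDerivAt_sin θ).fun_mul
        ((J.zt_t r θ φ).inner ℝ (J.zr_t r θ φ))) fun φ => by simp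
  have i3 : sphInt (fun θ φ => (1 - Real.sin θ ^ 2 / 2) ^ 2 *
      (inner ℝ (J.W r θ φ) (Real.sin θ • J.Wr r θ φ) + inner ℝ (J.Wp r θ φ) (J.zr r θ φ))) = 0 :=
    sphInt_deriv_phi
      (Q := fun θ φ => (1 - Real.sin θ ^ 2 / 2) ^ 2 * inner ℝ (J.W r θ φ) (J.zr r θ φ))
      (by fun_prop) (fun θ φ => ((J.W_p r θ φ).inner ℝ (J.zr_p r θ φ)).const_mul _) fun θ => by
        simp only [J.zr_periodic, J.W_periodic]
  have expand : J.eR r = sphInt (fun θ φ =>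
      ((r - 1) ^ 2 * (2 * inner ℝ (J.zr r θ φ) (J.zrr r θ φ) * Real.sin θ)
        + 4 * (r - 1) / (r + 1) * (‖J.zr r θ φ‖ ^ 2 * Real.sin θ)
        + -1 * ((2 * inner ℝ (J.zt r θ φ) (J.zrt r θ φ)
          + (1 - Real.sin θ ^ 2 / 2) ^ 2 * (2 * inner ℝ (J.W r θ φ) (J.Wr r θ φ))) * Real.sin θ)
        + -((2 * r - 1) / (r + 1) ^ 2) * (2 * inner ℝ (z r θ φ) (J.zr r θ φ) * Real.sin θ)
        + -(r ^ 2 - 1) * (Real.sin θ * (2 * inner ℝ (J.zr r θ φ) (Real.sin θ • J.Wr r θ φ)))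
        + 2 * (Real.cos θ * inner ℝ (J.zt r θ φ) (J.zr r θ φ) + Real.sin θ *
          (inner ℝ (J.zt r θ φ) (J.zrt r θ φ) + inner ℝ (J.ztt r θ φ) (J.zr r θ φ)))
        + 2 * ((1 - Real.sin θ ^ 2 / 2) ^ 2 *
          (inner ℝ (J.W r θ φ) (Real.sin θ • J.Wr r θ φ)
            + inner ℝ (J.Wp r θ φ) (J.zr r θ φ))))) := by
    unfold eR
    congr 1
    ext θ φ
    have hS := congrArg (fun v => inner ℝ v (J.zr r θ φ)) (J.sin_smul_S r θ φ)
    simp only [inner_add_left, real_inner_smul_left] at hS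
    simp only [conj, abs_of_nonneg hr, inner_add_left, inner_sub_left, real_inner_smul_left,
      real_inner_smul_right, real_inner_self_eq_norm_sq]
    rw [real_inner_comm (J.zr r θ φ) (J.zrr r θ φ), real_inner_comm (J.zr r θ φ) (J.Wr r θ φ)]
    linear_combination 2 * hS
  rw [expand, sphInt_add, sphInt_add, sphInt_add, sphInt_add, sphInt_add, sphInt_add]
  · simp only [sphInt_const_mul, i1, i2, i3]
    unfold eN' eN eA' eZ'
    ring
  all_goals fun_prop

end SphericalJet

section Frame

/-- The unit vector with spherical coordinates `(θ,φ)`. -/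
def sphN (θ φ : ℝ) : Fin 3 → ℝ :=
  ![Real.sin θ * Real.cos φ, Real.sin θ * Real.sin φ, Real.cos θ]
/-- The polar unit tangent vector. -/
def sphT (θ φ : ℝ) : Fin 3 → ℝ :=
  ![Real.cos θ * Real.cos φ, Real.cos θ * Real.sin φ, -Real.sin θ]
/-- The azimuthal unit tangent vector. -/
def sphP (φ : ℝ) : Fin 3 → ℝ := ![-Real.sin φ, Real.cos φ, 0]
/-- The cylindrical radial unit vector. -/
def cylR (φ : ℝ) : Fin 3 → ℝ := ![Real.cos φ, Real.sin φ, 0]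

lemma hasDerivAt_sphN_theta (θ φ : ℝ) : HasDerivAt (fun t => sphN t φ) (sphT θ φ) θ := by
  rw [hasDerivAt_pi]
  intro i
  fin_cases i
  · exact (Real.hasDerivAt_sin θ).mul_const _
  · exact (Real.hasDerivAt_sin θ).mul_const _
  · exact Real.hasDerivAt_cos θ

lemma hasDerivAt_sphN_phi (θ φ : ℝ) :
    HasDerivAt (fun q => sphN θ q) (Real.sin θ • sphP φ) φ := by
  rw [hasDerivAt_pi]
  intro i
  fin_cases i
  · exact (Real.hasDerivAt_cos φ).const_mul _
  · exact (Real.hasDerivAt_sin φ).const_mul _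
  · simpa [sphN, sphP] using hasDerivAt_const φ (Real.cos θ)

lemma hasDerivAt_sphT_theta (θ φ : ℝ) : HasDerivAt (fun t => sphT t φ) (-sphN θ φ) θ := by
  rw [hasDerivAt_pi]
  intro i
  fin_cases i
  · exact ((Real.hasDerivAt_cos θ).mul_const _).congr_deriv (by simp [sphN])
  · exact ((Real.hasDerivAt_cos θ).mul_const _).congr_deriv (by simp [sphN])
  · exact (Real.hasDerivAt_sin θ).neg

lemma hasDerivAt_sphP (φ : ℝ) : HasDerivAt sphP (-cylR φ) φ := by
  rw [hasDerivAt_pi]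
  intro i
  fin_cases i
  · exact (Real.hasDerivAt_sin φ).neg
  · exact Real.hasDerivAt_cos φ
  · simpa [sphP, cylR] using hasDerivAt_const φ (0 : ℝ)

lemma cos_smul_sphT_sub_cylR (θ φ : ℝ) :
    Real.cos θ • sphT θ φ - cylR φ = -(Real.sin θ • sphN θ φ) := by
  have h := Real.sin_sq_add_cos_sq θ
  ext i
  fin_cases i
  · simp [sphN, sphT, cylR]; linear_combination Real.cos φ * h
  · simp [sphN, sphT, cylR]; linear_combination Real.sin φ * h
  · simp [sphN, sphT, cylR]; ring

lemma continuous_sphN : Continuous fun x : ℝ × ℝ => sphN x.1 x.2 := by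
  refine continuous_pi fun i => ?_
  fin_cases i <;> simp [sphN] <;> fun_prop

lemma continuous_sphT : Continuous fun x : ℝ × ℝ => sphT x.1 x.2 := by
  refine continuous_pi fun i => ?_
  fin_cases i <;> simp [sphT] <;> fun_prop

lemma continuous_sphP : Continuous sphP :=
  continuous_iff_continuousAt.2 fun φ => (hasDerivAt_sphP φ).continuousAt

lemma continuous_cylR : Continuous cylR := by
  refine continuous_pi fun i => ?_
  fin_cases i <;> simp [cylR] <;> fun_prop

end Frame

section Jet

variable {E F : Type*} [NormedAddCommGroup E] [NormedSpace ℝ E] [NormedAddCommGroup F]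
  [NormedSpace ℝ F]

lemma hasDerivAt_comp_of_contDiff {V : E → F} (hV : ContDiff ℝ (⊤ : ℕ∞) V) {x : ℝ → E} {x' : E}
    {t : ℝ} (hx : HasDerivAt x x' t) :
    HasDerivAt (fun s => V (x s)) (fderiv ℝ V (x t) x') t :=
  ((hV.differentiable (by simp)).differentiableAt.hasFDerivAt (x := x t)).comp_hasDerivAt t hx

lemma hasDerivAt_fderiv_apply {V : E → F} (hV : ContDiff ℝ (⊤ : ℕ∞) V) {x v : ℝ → E} {x' v' : E}
    {t : ℝ} (hx : HasDerivAt x x' t) (hv : HasDerivAt v v' t) :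
    HasDerivAt (fun s => fderiv ℝ V (x s) (v s))
      (fderiv ℝ (fderiv ℝ V) (x t) x' (v t) + fderiv ℝ V (x t) v') t :=
  (hasDerivAt_comp_of_contDiff (hV.fderiv_right (by simp)) hx).clm_apply hv

lemma fderiv_fderiv_comm {V : E → F} (hV : ContDiff ℝ (⊤ : ℕ∞) V) (x v w : E) :
    fderiv ℝ (fderiv ℝ V) x v w = fderiv ℝ (fderiv ℝ V) x w v :=
  (hV.contDiffAt.isSymmSndFDerivAt (by rw [minSmoothness_of_isRCLikeNormedField]; exact WithTop.coe_le_coe.2 (le_top (a := (2 : ℕ∞))))).eq v w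

/-- The spherical jet of a smooth function on `ℝ × ℝ³`. -/
def jetOf (V : ℝ × (Fin 3 → ℝ) → F) (hV : ContDiff ℝ (⊤ : ℕ∞) V) :
    SphericalJet fun r θ φ => V (r, sphN θ φ) where
  zr r θ φ := fderiv ℝ V (r, sphN θ φ) (1, 0)
  zt r θ φ := fderiv ℝ V (r, sphN θ φ) (0, sphT θ φ)
  W r θ φ := fderiv ℝ V (r, sphN θ φ) (0, sphP φ)
  zrr r θ φ := fderiv ℝ (fderiv ℝ V) (r, sphN θ φ) (1, 0) (1, 0)
  zrt r θ φ := fderiv ℝ (fderiv ℝ V) (r, sphN θ φ) (1, 0) (0, sphT θ φ)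
  Wr r θ φ := fderiv ℝ (fderiv ℝ V) (r, sphN θ φ) (1, 0) (0, sphP φ)
  ztt r θ φ := fderiv ℝ (fderiv ℝ V) (r, sphN θ φ) (0, sphT θ φ) (0, sphT θ φ)
    - fderiv ℝ V (r, sphN θ φ) (0, sphN θ φ)
  Wp r θ φ := Real.sin θ • fderiv ℝ (fderiv ℝ V) (r, sphN θ φ) (0, sphP φ) (0, sphP φ)
    - fderiv ℝ V (r, sphN θ φ) (0, cylR φ)
  S r θ φ := fderiv ℝ (fderiv ℝ V) (r, sphN θ φ) (0, sphT θ φ) (0, sphT θ φ)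
    + fderiv ℝ (fderiv ℝ V) (r, sphN θ φ) (0, sphP φ) (0, sphP φ)
    - (2 : ℝ) • fderiv ℝ V (r, sphN θ φ) (0, sphN θ φ)
  continuous_z := by
    have := hV.continuous
    have := continuous_sphN
    fun_prop
  continuous_zr := by
    have := (hV.fderiv_right (m := (⊤ : ℕ∞)) (by simp)).continuous
    have := continuous_sphN
    fun_prop
  continuous_zt := by
    have := (hV.fderiv_right (m := (⊤ : ℕ∞)) (by simp)).continuous
    have := continuous_sphN
    have := continuous_sphT
    fun_prop
  continuous_W := by
    have := (hV.fderiv_right (m := (⊤ : ℕ∞)) (by simp)).continuous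
    have := continuous_sphN
    have := continuous_sphP
    fun_prop
  continuous_zrr := by
    have := ((hV.fderiv_right (m := (⊤ : ℕ∞)) (by simp)).fderiv_right
      (m := (⊤ : ℕ∞)) (by simp)).continuous
    have := continuous_sphN
    fun_prop
  continuous_zrt := by
    have := ((hV.fderiv_right (m := (⊤ : ℕ∞)) (by simp)).fderiv_right
      (m := (⊤ : ℕ∞)) (by simp)).continuous
    have := continuous_sphN
    have := continuous_sphT
    fun_prop
  continuous_Wr := by
    have := ((hV.fderiv_right (m := (⊤ : ℕ∞)) (by simp)).fderiv_right
      (m := (⊤ : ℕ∞)) (by simp)).continuous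
    have := continuous_sphN
    have := continuous_sphP
    fun_prop
  continuous_ztt := by
    have := (hV.fderiv_right (m := (⊤ : ℕ∞)) (by simp)).continuous
    have := ((hV.fderiv_right (m := (⊤ : ℕ∞)) (by simp)).fderiv_right
      (m := (⊤ : ℕ∞)) (by simp)).continuous
    have := continuous_sphN
    have := continuous_sphT
    fun_prop
  continuous_Wp := by
    have := (hV.fderiv_right (m := (⊤ : ℕ∞)) (by simp)).continuous
    have := ((hV.fderiv_right (m := (⊤ : ℕ∞)) (by simp)).fderiv_right
      (m := (⊤ : ℕ∞)) (by simp)).continuous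
    have := continuous_sphN
    have := continuous_sphP
    have := continuous_cylR
    fun_prop
  continuous_S := by
    have := (hV.fderiv_right (m := (⊤ : ℕ∞)) (by simp)).continuous
    have := ((hV.fderiv_right (m := (⊤ : ℕ∞)) (by simp)).fderiv_right
      (m := (⊤ : ℕ∞)) (by simp)).continuous
    have := continuous_sphN
    have := continuous_sphT
    have := continuous_sphP
    fun_prop
  z_r r θ φ := hasDerivAt_comp_of_contDiff hV ((hasDerivAt_id r).prodMk (hasDerivAt_const r _))
  z_t r θ φ := hasDerivAt_comp_of_contDiff hV
    ((hasDerivAt_const θ r).prodMk (hasDerivAt_sphN_theta θ φ))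
  z_p r θ φ := (hasDerivAt_comp_of_contDiff hV
    ((hasDerivAt_const φ r).prodMk (hasDerivAt_sphN_phi θ φ))).congr_deriv (by
      rw [← map_smul, Prod.smul_mk, smul_zero])
  zr_r r θ φ := (hasDerivAt_fderiv_apply hV
    ((hasDerivAt_id r).prodMk (hasDerivAt_const r _)) (hasDerivAt_const r _)).congr_deriv (by simp)
  zr_t r θ φ := (hasDerivAt_fderiv_apply hV
    ((hasDerivAt_const θ r).prodMk (hasDerivAt_sphN_theta θ φ)) (hasDerivAt_const θ _)).congr_deriv
      (by rw [map_zero, add_zero, fderiv_fderiv_comm hV])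
  zr_p r θ φ := (hasDerivAt_fderiv_apply hV
    ((hasDerivAt_const φ r).prodMk (hasDerivAt_sphN_phi θ φ)) (hasDerivAt_const φ _)).congr_deriv
      (by rw [map_zero, add_zero, fderiv_fderiv_comm hV, ← map_smul, Prod.smul_mk, smul_zero])
  zt_r r θ φ := (hasDerivAt_fderiv_apply hV
    ((hasDerivAt_id r).prodMk (hasDerivAt_const r _)) (hasDerivAt_const r _)).congr_deriv (by simp)
  zt_t r θ φ := (hasDerivAt_fderiv_apply hV
    ((hasDerivAt_const θ r).prodMk (hasDerivAt_sphN_theta θ φ))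
    ((hasDerivAt_const θ 0).prodMk (hasDerivAt_sphT_theta θ φ))).congr_deriv (by
      rw [sub_eq_add_neg, ← map_neg, Prod.neg_mk, neg_zero])
  W_r r θ φ := (hasDerivAt_fderiv_apply hV
    ((hasDerivAt_id r).prodMk (hasDerivAt_const r _)) (hasDerivAt_const r _)).congr_deriv (by simp)
  W_p r θ φ := (hasDerivAt_fderiv_apply hV
    ((hasDerivAt_const φ r).prodMk (hasDerivAt_sphN_phi θ φ))
    ((hasDerivAt_const φ 0).prodMk (hasDerivAt_sphP φ))).congr_deriv (by
      rw [sub_eq_add_neg, ← map_neg, Prod.neg_mk, neg_zero, ← smul_apply,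
        ← map_smul, Prod.smul_mk, smul_zero])
  sin_smul_S r θ φ := by
    have h := congrArg (fun v => fderiv ℝ V (r, sphN θ φ) ((0 : ℝ), v))
      (cos_smul_sphT_sub_cylR θ φ)
    have e1 : ((0 : ℝ), Real.cos θ • sphT θ φ - cylR φ)
        = Real.cos θ • ((0 : ℝ), sphT θ φ) - (0, cylR φ) := by simp
    have e2 : ((0 : ℝ), -(Real.sin θ • sphN θ φ)) = -(Real.sin θ • ((0 : ℝ), sphN θ φ)) := by simp
    simp only [e1, e2, map_sub, map_neg, map_smul] at h
    rw [sub_eq_iff_eq_add] at h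
    rw [h]
    module
  zr_periodic r θ := by simp [sphN]
  W_periodic r θ := by simp [sphN, sphP]

end Jet

section Operator

variable {z : ℝ → ℝ → ℝ → ℂ} {U : ℝ × (Fin 3 → ℝ) → ℂ}

lemma hasDerivAt_inv_sqrt_sq_sub_one {r : ℝ} (hr : 1 < r) :
    HasDerivAt (fun s : ℝ => (Real.sqrt (s ^ 2 - 1))⁻¹)
      (-(r / (r ^ 2 - 1)) * (Real.sqrt (r ^ 2 - 1))⁻¹) r := by
  have h0 : 0 < r ^ 2 - 1 := by nlinarith
  have hs : HasDerivAt (fun s : ℝ => s ^ 2 - 1) (2 * r) r := by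
    simpa using (hasDerivAt_pow 2 r).sub_const 1
  refine ((hs.sqrt h0.ne').fun_inv (Real.sqrt_pos.2 h0).ne').congr_deriv ?_
  rw [Real.sq_sqrt h0.le]
  have := (Real.sqrt_pos.2 h0).ne'
  field_simp

lemma dR_utld (J : SphericalJet (utld U)) (r θ φ : ℝ) : dR (utld U) r θ φ = J.zr r θ φ :=
  (J.z_r r θ φ).deriv

lemma dTh_utld (J : SphericalJet (utld U)) (r θ φ : ℝ) : dTh (utld U) r θ φ = J.zt r θ φ :=
  (J.z_t r θ φ).deriv

lemma dPh_utld (J : SphericalJet (utld U)) (r θ φ : ℝ) :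
    dPh (utld U) r θ φ = Real.sin θ • J.W r θ φ :=
  (J.z_p r θ φ).deriv

lemma usph_eq_smul_utld {r : ℝ} (hr : 1 < r) (θ φ : ℝ) :
    usph U r θ φ = (Real.sqrt (r ^ 2 - 1))⁻¹ • utld U r θ φ := by
  have h0 : 0 < r ^ 2 - 1 := by nlinarith
  have := (Real.sqrt_pos.2 h0).ne'
  rw [utld, ← Complex.real_smul, inv_smul_smul₀ this]

/-- Conjugation of `ℒ` by the weight `√(r²-1)`. -/
lemma Lell_eq (J : SphericalJet (utld U)) {r θ φ : ℝ} (hr : 1 < r) (hθ : Real.sin θ ≠ 0) :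
    Lell U r θ φ = (Real.sqrt (r ^ 2 - 1))⁻¹ • J.conj r θ φ := by
  set g : ℝ → ℝ := fun s => (Real.sqrt (s ^ 2 - 1))⁻¹ with hg
  have hgd : ∀ s, 1 < s → HasDerivAt g (-(s / (s ^ 2 - 1)) * g s) s := fun s hs =>
    hasDerivAt_inv_sqrt_sq_sub_one hs
  have hu : ∀ s, 1 < s → ∀ θ φ, usph U s θ φ = g s • utld U s θ φ := fun s hs θ φ =>
    usph_eq_smul_utld hs θ φ
  have hnear : ∀ s : ℝ, 1 < s → ∀ᶠ x in nhds s, 1 < x := fun s hs => lt_mem_nhds hs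
  have hR : ∀ s, 1 < s → dR (usph U) s θ φ =
      g s • J.zr s θ φ + (-(s / (s ^ 2 - 1)) * g s) • utld U s θ φ := fun s hs => by
    have := (hgd s hs).fun_smul (J.z_r s θ φ)
    exact (this.congr_of_eventuallyEq ((hnear s hs).mono fun x hx => hu x hx θ φ)).deriv
  have hP : ∀ s, 1 < s → ∀ q, dPh (usph U) s θ q = g s • Real.sin θ • J.W s θ q := fun s hs q => by
    have := (J.z_p s θ q).fun_const_smul (g s)
    simp only [dPh, hu s hs]
    exact this.deriv
  have hT : ∀ t, dTh (usph U) r t φ = g r • J.zt r t φ := fun t => by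
    have := (J.z_t r t φ).fun_const_smul (g r)
    simp only [dTh, hu r hr]
    exact this.deriv
  have hPP : deriv (fun q => dPh (usph U) r θ q) φ = g r • Real.sin θ • J.Wp r θ φ := by
    simp only [hP r hr]
    exact (((J.W_p r θ φ).fun_const_smul (Real.sin θ)).fun_const_smul (g r)).deriv
  have hTT : deriv (fun t => ((Real.sin t : ℝ) : ℂ) * dTh (usph U) r t φ) θ =
      Real.sin θ • g r • J.ztt r θ φ + Real.cos θ • g r • J.zt r θ φ := by
    simp only [hT, ← Complex.real_smul]
    exact ((Real.hasDerivAt_sin θ).fun_smul ((J.zt_t r θ φ).fun_const_smul (g r))).deriv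
  have hRP : deriv (fun s => dPh (usph U) s θ φ) r =
      g r • Real.sin θ • J.Wr r θ φ + (-(r / (r ^ 2 - 1)) * g r) • Real.sin θ • J.W r θ φ :=
    (((hgd r hr).fun_smul ((J.W_r r θ φ).fun_const_smul (Real.sin θ))).congr_of_eventuallyEq
      ((hnear r hr).mono fun x hx => hP x hx φ)).deriv
  have hRR : deriv (fun s => (((s - 1) ^ 2 : ℝ) : ℂ) * dR (usph U) s θ φ) r =
      g r • ((r - 1) ^ 2 • J.zrr r θ φ + (2 * (r - 1) / (r + 1)) • J.zr r θ φ
        - ((2 * r - 1) / (r + 1) ^ 2) • utld U r θ φ) := by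
    have hr1 : r + 1 ≠ 0 := by linarith
    have hr2 : r - 1 ≠ 0 := by linarith
    have hr3 : r ^ 2 - 1 ≠ 0 := by nlinarith
    have d1 : HasDerivAt (fun s : ℝ => (s - 1) ^ 2) (2 * (r - 1)) r := by
      simpa using ((hasDerivAt_id r).sub_const 1).fun_pow 2
    have d2 : HasDerivAt (fun s : ℝ => s * (s - 1) / (s + 1)) ((r ^ 2 + 2 * r - 1) / (r + 1) ^ 2)
        r := by
      refine (((hasDerivAt_id r).fun_mul ((hasDerivAt_id r).sub_const 1)).fun_div
        ((hasDerivAt_id r).add_const 1) hr1).congr_deriv ?_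
      simp only [id]
      congr 1
      ring
    have d3 := (hgd r hr).fun_smul ((d1.fun_smul (J.zr_r r θ φ)).fun_sub (d2.fun_smul (J.z_r r θ φ)))
    refine (d3.congr_of_eventuallyEq ((hnear r hr).mono fun s hs => ?_)).deriv.trans ?_
    · have hs1 : s + 1 ≠ 0 := by linarith
      have hs3 : s ^ 2 - 1 ≠ 0 := by nlinarith
      have e : (s - 1) ^ 2 * (-(s / (s ^ 2 - 1)) * g s) = -(g s * (s * (s - 1) / (s + 1))) := by
        field_simp; ring
      simp only [hR s hs, ← Complex.real_smul]
      rw [smul_add, smul_smul _ (-(s / (s ^ 2 - 1)) * g s), e]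
      module
    · match_scalars <;> field_simp <;> ring
  have hS : ((Real.sin θ : ℝ) : ℂ)⁻¹ *
        deriv (fun t => ((Real.sin t : ℝ) : ℂ) * dTh (usph U) r t φ) θ
      + ((Real.sin θ ^ 2 : ℝ) : ℂ)⁻¹ * deriv (fun q => dPh (usph U) r θ q) φ
      = g r • J.S r θ φ := by
    have hS' : J.S r θ φ = (Real.sin θ)⁻¹ •
        (Real.cos θ • J.zt r θ φ + Real.sin θ • J.ztt r θ φ + J.Wp r θ φ) := by
      rw [← J.sin_smul_S, inv_smul_smul₀ hθ]
    rw [hTT, hPP, hS', ← Complex.ofReal_inv, ← Complex.ofReal_inv, ← Complex.real_smul,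
      ← Complex.real_smul]
    match_scalars <;> field_simp
  rw [Lell, hRR, add_assoc (_ - _ - _), hS, hRP, hPP, hP r hr, SphericalJet.conj,
    abs_of_pos (zero_lt_one.trans hr)]
  simp only [← Complex.real_smul]
  have hr3 : r ^ 2 - 1 ≠ 0 := by nlinarith
  have e : (r ^ 2 - 1) * (-(r / (r ^ 2 - 1)) * g r) = -(r * g r) := by
    field_simp
  rw [smul_add (r ^ 2 - 1), smul_smul (r ^ 2 - 1) (-(r / (r ^ 2 - 1)) * g r), e]
  module

end Operator

section Support

variable {E F : Type*} [NormedAddCommGroup E] [NormedSpace ℝ E] [NormedAddCommGroup F]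
  [NormedSpace ℝ F]

lemma jet_eq_zero_of_notMem_tsupport {V : E → F} {x : E} (hx : x ∉ tsupport V) :
    V x = 0 ∧ fderiv ℝ V x = 0 ∧ fderiv ℝ (fderiv ℝ V) x = 0 :=
  ⟨image_eq_zero_of_notMem_tsupport hx,
    image_eq_zero_of_notMem_tsupport fun h => hx (tsupport_fderiv_subset ℝ h),
    image_eq_zero_of_notMem_tsupport fun h =>
      hx (tsupport_fderiv_subset ℝ (tsupport_fderiv_subset ℝ h))⟩

lemma contDiff_sqrt_mul {U : ℝ × E → ℂ} (hU : ContDiff ℝ (⊤ : ℕ∞) U)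
    (hsupp : ∀ x ∈ tsupport U, 1 < x.1) :
    ContDiff ℝ (⊤ : ℕ∞) fun x : ℝ × E => (Real.sqrt (x.1 ^ 2 - 1) : ℂ) * U x := by
  refine contDiff_iff_contDiffAt.2 fun x => ?_
  by_cases hx : x ∈ tsupport fun x : ℝ × E => (Real.sqrt (x.1 ^ 2 - 1) : ℂ) * U x
  swap
  · exact contDiffAt_const.congr_of_eventuallyEq (notMem_tsupport_iff_eventuallyEq.1 hx)
  have hx1 : 1 < x.1 := hsupp x (tsupport_mul_subset_right hx)
  have h0 : x.1 ^ 2 - 1 ≠ 0 := by nlinarith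
  have hs : ContDiffAt ℝ (⊤ : ℕ∞) (fun x : ℝ × E => Real.sqrt (x.1 ^ 2 - 1)) x :=
    ContDiffAt.sqrt (by fun_prop) h0
  exact (Complex.ofRealCLM.contDiff.contDiffAt.comp x hs).mul hU.contDiffAt

end Support

lemma exists_fst_mem_Ioo_of_hasCompactSupport {E F : Type*}
    [TopologicalSpace E] [Zero F] {U : ℝ × E → F} (hU : HasCompactSupport U)
    (hsupp : ∀ x ∈ tsupport U, 1 < x.1) :
    ∃ a b : ℝ, 1 < a ∧ a < b ∧ ∀ x ∈ tsupport U, x.1 ∈ Set.Ioo a b := by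
  rcases (tsupport U).eq_empty_or_nonempty with h | h
  · exact ⟨2, 3, by norm_num, by norm_num, by simp [h]⟩
  obtain ⟨x, hx, hmin⟩ := IsCompact.exists_isMinOn hU h continuous_fst.continuousOn
  obtain ⟨y, hy, hmax⟩ := IsCompact.exists_isMaxOn hU h continuous_fst.continuousOn
  have h1 := hsupp x hx
  have h2 := hmin hy
  refine ⟨(1 + x.1) / 2, y.1 + 1, by linarith, ?_, fun w hw => ⟨?_, ?_⟩⟩
  · have : x.1 ≤ y.1 := h2
    linarith
  · have : x.1 ≤ w.1 := hmin hw
    linarith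
  · have : w.1 ≤ y.1 := hmax hw
    linarith

lemma jetOf_energies_eq_zero {F : Type*} [NormedAddCommGroup F] [InnerProductSpace ℝ F]
    {V : ℝ × (Fin 3 → ℝ) → F} (hV : ContDiff ℝ (⊤ : ℕ∞) V) {r : ℝ}
    (hr : ∀ n, (r, n) ∉ tsupport V) :
    (jetOf V hV).eN r = 0 ∧ (jetOf V hV).eA r = 0 ∧ (jetOf V hV).eZ r = 0 ∧
      (jetOf V hV).eN' r = 0 ∧ (jetOf V hV).eA' r = 0 ∧ (jetOf V hV).eZ' r = 0 ∧
      (jetOf V hV).eD r = 0 ∧ (jetOf V hV).eL r = 0 := by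
  have h0 := fun n => (jet_eq_zero_of_notMem_tsupport (hr n)).1
  have h1 := fun n => (jet_eq_zero_of_notMem_tsupport (hr n)).2.1
  have h2 := fun n => (jet_eq_zero_of_notMem_tsupport (hr n)).2.2
  simp [SphericalJet.eN, SphericalJet.eA, SphericalJet.eZ, SphericalJet.eN', SphericalJet.eA',
    SphericalJet.eZ', SphericalJet.eD, SphericalJet.eL, SphericalJet.conj, jetOf, sphInt, h0, h1,
    h2]

section Densities

variable {U : ℝ × (Fin 3 → ℝ) → ℂ} (J : SphericalJet (utld U))

lemma setIntegral_energy_eq (c d r : ℝ) :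
    ∫ θ in Set.Ioo (0 : ℝ) Real.pi, ∫ φ in Set.Ioo (0 : ℝ) (2 * Real.pi),
      (c * ‖dR (utld U) r θ φ‖ ^ 2 + d * (‖dTh (utld U) r θ φ‖ ^ 2
        + ((Real.sin θ ^ 2)⁻¹ + 1 / 4 * Real.sin θ ^ 2) * ‖dPh (utld U) r θ φ‖ ^ 2)) * Real.sin θ
      = c * J.eN r + d * J.eD r := by
  have h1 := J.continuous_zr
  have h2 := J.continuous_zt
  have h3 := J.continuous_W
  rw [SphericalJet.eN, SphericalJet.eD, ← sphInt_const_mul, ← sphInt_const_mul,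
    ← sphInt_add (by fun_prop) (by fun_prop)]
  refine setIntegral_eq_sphInt fun θ hθ φ => ?_
  have hs := (Real.sin_pos_of_mem_Ioo hθ).ne'
  rw [dR_utld J, dTh_utld J, dPh_utld J, norm_smul, mul_pow, Real.norm_eq_abs, sq_abs]
  field_simp

lemma setIntegral_dR_eq (c r : ℝ) :
    ∫ θ in Set.Ioo (0 : ℝ) Real.pi, ∫ φ in Set.Ioo (0 : ℝ) (2 * Real.pi),
      (c * ‖dR (utld U) r θ φ‖ ^ 2) * Real.sin θ = c * J.eN r := by
  rw [SphericalJet.eN, ← sphInt_const_mul]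
  exact setIntegral_eq_sphInt fun θ hθ φ => by rw [dR_utld J, mul_assoc]

lemma setIntegral_Lell_eq (c : ℝ) {r : ℝ} (hr : 1 < r) :
    ∫ θ in Set.Ioo (0 : ℝ) Real.pi, ∫ φ in Set.Ioo (0 : ℝ) (2 * Real.pi),
      (c * ‖Lell U r θ φ‖ ^ 2) * Real.sin θ = c * (J.eL r / (r ^ 2 - 1)) := by
  have h0 : 0 < r ^ 2 - 1 := by nlinarith
  have e : c * (J.eL r / (r ^ 2 - 1)) = (c / (r ^ 2 - 1)) * J.eL r := by ring
  rw [e, SphericalJet.eL, ← sphInt_const_mul]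
  refine setIntegral_eq_sphInt fun θ hθ φ => ?_
  rw [Lell_eq J hr (Real.sin_pos_of_mem_Ioo hθ).ne', norm_smul, mul_pow, norm_inv, inv_pow,
    Real.norm_eq_abs, sq_abs, Real.sq_sqrt h0.le]
  ring

end Densities

/-- Proposition 9.1: global degenerate elliptic estimate for the
extremal-Kerr K-inversion operator, for smooth compactly supported data supported in
`{r > 1}` and on nonzero azimuthal modes. -/
theorem degenerate_elliptic_estimate (p δ rH : ℝ) (hp0 : 0 < p) (hp2 : p ≤ 2)
    (hδ : 0 ≤ δ) (hrH1 : 1 < rH) (hrH2 : rH ≤ 2) :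
    ∃ C > 0, ∀ U : ℝ × (Fin 3 → ℝ) → ℂ,
      ContDiff ℝ (⊤ : ℕ∞) U → HasCompactSupport U →
      (∀ x ∈ tsupport U, 1 < x.1) →
      (∀ r θ : ℝ, (∫ φ in (0 : ℝ)..(2 * Real.pi), usph U r θ φ) = 0) →
      ∀ ε : ℝ, 0 < ε → ε ≤ 1 →
        (∫ r in Set.Ioi (1 : ℝ), ∫ θ in Set.Ioo (0 : ℝ) Real.pi,
            ∫ φ in Set.Ioo (0 : ℝ) (2 * Real.pi),
              (p * r ^ (p - 1) * (1 - r⁻¹) ^ 2 * ‖dR (utld U) r θ φ‖ ^ 2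
                + (2 - p) * r ^ (p - 3) *
                  (‖dTh (utld U) r θ φ‖ ^ 2
                    + ((Real.sin θ ^ 2)⁻¹ + 1 / 4 * Real.sin θ ^ 2)
                        * ‖dPh (utld U) r θ φ‖ ^ 2))
                * Real.sin θ)
          ≤ ε * (∫ r in Set.Ioc (1 : ℝ) rH, ∫ θ in Set.Ioo (0 : ℝ) Real.pi,
                ∫ φ in Set.Ioo (0 : ℝ) (2 * Real.pi),
                  ((1 - r⁻¹) ^ (1 + δ) * ‖dR (utld U) r θ φ‖ ^ 2) * Real.sin θ)
            + C * ε⁻¹ * (∫ r in Set.Ioi (1 : ℝ), ∫ θ in Set.Ioo (0 : ℝ) Real.pi,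
                ∫ φ in Set.Ioo (0 : ℝ) (2 * Real.pi),
                  (r ^ (p - 1) * (1 - r⁻¹) ^ (-δ) * ‖Lell U r θ φ‖ ^ 2) * Real.sin θ) := by
  obtain ⟨C, hC, hest⟩ := radial_estimate hp0 hp2 hδ hrH1 hrH2
  refine ⟨C, hC, fun U hU hUc hsupp hmean ε hε hε1 => ?_⟩
  obtain ⟨a, b, ha, hab, hsub⟩ := exists_fst_mem_Ioo_of_hasCompactSupport hUc hsupp
  have hV := contDiff_sqrt_mul hU hsupp
  set V : ℝ × (Fin 3 → ℝ) → ℂ := fun x => (Real.sqrt (x.1 ^ 2 - 1) : ℂ) * U x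
  let J : SphericalJet (utld U) := jetOf V hV
  have hzero : ∀ r ∉ Set.Ioo a b, J.eN r = 0 ∧ J.eA r = 0 ∧ J.eZ r = 0 ∧ J.eN' r = 0 ∧
      J.eA' r = 0 ∧ J.eZ' r = 0 ∧ J.eD r = 0 ∧ J.eL r = 0 := fun r hr =>
    jetOf_energies_eq_zero hV fun n hn => hr (hsub _ (tsupport_mul_subset_right hn))
  have hmeanV : ∀ r θ, ∫ φ in (0 : ℝ)..(2 * Real.pi), utld U r θ φ = 0 := fun r θ => by
    simp only [utld, intervalIntegral.integral_const_mul, hmean, mul_zero]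
  have hsq : ∀ r : ℝ, 1 < r → 0 < r ^ 2 - 1 := fun r hr => by nlinarith
  have key := hest (Y := fun r => J.eL r / (r ^ 2 - 1)) (R := J.eR) ha hab J.hasDerivAt_eN
    J.hasDerivAt_eA J.hasDerivAt_eZ J.continuous_eN' J.continuous_eA' J.continuous_eZ' J.continuous_eD
    (J.continuous_eL.continuousOn.div (by fun_prop) fun r hr => (hsq r hr).ne')
    (fun r hr => by
      obtain ⟨h1, h2, h3, h4, h5, h6, h7, h8⟩ := hzero r hr
      exact ⟨h1, h2, h3, h4, h5, h6, h7, by rw [h8, zero_div]⟩)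
    (fun r hr => ⟨J.eN_nonneg r, J.eZ_nonneg r, div_nonneg (J.eL_nonneg r) (hsq r hr).le,
      J.eD_nonneg r, J.eZ_le (hmeanV r), J.eD_le r⟩)
    (fun r hr => J.eR_eq (by linarith))
    (fun r hr t ht => by
      rw [mul_div_cancel₀ _ (hsq r hr).ne']
      exact J.neg_eR_le r ht) ε hε hε1
  refine (Eq.trans_le ?_ key).trans_eq ?_
  · exact setIntegral_congr_fun measurableSet_Ioi fun r _ => setIntegral_energy_eq J _ _ r
  · congr 2
    · exact setIntegral_congr_fun measurableSet_Ioc fun r _ => (setIntegral_dR_eq J _ r).symm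
    · exact setIntegral_congr_fun measurableSet_Ioi fun r hr => (setIntegral_Lell_eq J _ hr).symm
end
end
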